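/- If Γ is a discrete abelian group and A, B ⊆ Γ are nonempty sets satisfying d*(A+B) < d*(A) + d*(B), then there is a finite-index subgroup K ≤ Γ satisfying d*(A+B) = d*(A+B+K). -/

import Mathlib

open scoped Pointwise
open Filter

namespace SumsetMeans

variable (Γ : Type*) [AddCommGroup Γ] [TopologicalSpace Γ] [DiscreteTopology Γ]

/-- The indicator function of `A ⊆ Γ` as a bounded (continuous, since `Γ` is discrete)
real-valued function, i.e. as an element of `ℓ^∞(Γ)`. -/
noncomputable def ind (A : Set Γ) : BoundedContinuousFunction Γ ℝ :=
  BoundedContinuousFunction.ofNormedAddCommGroup (Set.indicator A 1)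
    continuous_of_discreteTopology 1
    (fun x => by by_cases h : x ∈ A <;> simp [Set.indicator_apply, h])

/-- The translate `τ_γ f`, given by `(τ_γ f)(x) = f (x - γ)`. -/
noncomputable def translate (γ : Γ) (f : BoundedContinuousFunction Γ ℝ) :
    BoundedContinuousFunction Γ ℝ :=
  f.compContinuous ⟨fun x => x - γ, continuous_of_discreteTopology⟩

/-- An invariant mean on `ℓ^∞(Γ)`: a linear functional with `m 1 = 1`, nonnegative on
nonnegative functions, and invariant under all translations. -/
structure IsInvariantMean (m : BoundedContinuousFunction Γ ℝ →ₗ[ℝ] ℝ) : Prop where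
  map_one : m 1 = 1
  nonneg : ∀ f : BoundedContinuousFunction Γ ℝ, (∀ x, 0 ≤ f x) → 0 ≤ m f
  invariant : ∀ (γ : Γ) (f : BoundedContinuousFunction Γ ℝ), m (translate Γ γ f) = m f

/-- The value `m(A) := m(1_A)` of a mean on a set `A ⊆ Γ`. -/
noncomputable def mVal (m : BoundedContinuousFunction Γ ℝ →ₗ[ℝ] ℝ) (A : Set Γ) : ℝ :=
  m (ind Γ A)

/-- Upper Banach density: `d*(A) = sup { m(A) : m an invariant mean on ℓ^∞(Γ) }`. -/
noncomputable def ubd (A : Set Γ) : ℝ :=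
  sSup {x : ℝ | ∃ m, IsInvariantMean Γ m ∧ mVal Γ m A = x}

/-- An extreme invariant mean: an extreme point of the convex set of invariant means. -/
def IsExtremeInvariantMean (ν : BoundedContinuousFunction Γ ℝ →ₗ[ℝ] ℝ) : Prop :=
  ν ∈ Set.extremePoints ℝ {m : BoundedContinuousFunction Γ ℝ →ₗ[ℝ] ℝ | IsInvariantMean Γ m}

section FiniteKneser

variable {G : Type*} [AddCommGroup G] [Finite G]

theorem ncard_mul_ncard_le_card_inf (H₁ H₂ : AddSubgroup G) {P Q D : Set G}
    (hP : P ⊆ H₂) (hQ : Q ⊆ H₁) (c : G) (hD : ∀ p ∈ P, ∀ q ∈ Q, c + p + q ∈ D) :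
    P.ncard * Q.ncard ≤ Nat.card (H₁ ⊓ H₂ : AddSubgroup G) * D.ncard := by
  classical
  cases nonempty_fintype G
  rw [Set.ncard_eq_toFinset_card', Set.ncard_eq_toFinset_card', Set.ncard_eq_toFinset_card',
    ← Finset.card_product]
  refine Finset.card_le_mul_card_image_of_maps_to (f := fun x : G × G => c + x.1 + x.2) ?_ _ ?_
  · rintro ⟨p, q⟩ h
    simp only [Finset.mem_product, Set.mem_toFinset] at h ⊢
    exact hD p h.1 q h.2
  · intro d _
    rcases Finset.eq_empty_or_nonempty
      {x ∈ P.toFinset ×ˢ Q.toFinset | c + x.1 + x.2 = d} with h | ⟨⟨p₀, q₀⟩, h₀⟩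
    · rw [h]; simp
    · simp only [Finset.mem_filter, Finset.mem_product, Set.mem_toFinset] at h₀
      rw [Nat.card_eq_fintype_card, ← Finset.card_univ]
      have key : ∀ x ∈ ({x ∈ P.toFinset ×ˢ Q.toFinset | c + x.1 + x.2 = d} : Finset (G × G)),
          x.1 - p₀ ∈ H₁ ⊓ H₂ := by
        rintro ⟨p, q⟩ h
        simp only [Finset.mem_filter, Finset.mem_product, Set.mem_toFinset] at h
        refine ⟨?_, H₂.sub_mem (hP h.1.1) (hP h₀.1.1)⟩
        have : p - p₀ = q₀ - q := by
          have := h.2.trans h₀.2.symm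
          rw [sub_eq_sub_iff_add_eq_add]
          have h3 : c + (p + q) = c + (p₀ + q₀) := by rw [← add_assoc, ← add_assoc]; exact this
          rw [add_left_cancel h3, add_comm]
        simp only [this]
        exact H₁.sub_mem (hQ h₀.1.2) (hQ h.1.2)
      refine Finset.card_le_card_of_injOn
        (fun x => if h : x.1 - p₀ ∈ H₁ ⊓ H₂ then (⟨x.1 - p₀, h⟩ : (H₁ ⊓ H₂ : AddSubgroup G)) else 0)
        (fun _ _ => Finset.mem_univ _) ?_
      rintro ⟨p, q⟩ h ⟨p', q'⟩ h' he
      simp only [dif_pos (key _ h), dif_pos (key _ h'), Subtype.mk.injEq] at he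
      simp only [Finset.coe_filter, Finset.mem_product, Set.mem_toFinset, Set.mem_ofPred_eq] at h h'
      have e1 : p = p' := sub_left_injective he
      subst e1
      have := h.2.trans h'.2.symm
      simpa using this

omit [Finite G] in
theorem add_mem_iff_of_mem_stabilizer {C : Set G} {g : G}
    (hg : g ∈ AddAction.stabilizer G C) (x : G) : x + g ∈ C ↔ x ∈ C := by
  rw [AddAction.mem_stabilizer_iff] at hg
  conv_lhs => rw [← hg]
  rw [add_comm, ← vadd_eq_add, Set.vadd_mem_vadd_set_iff]

theorem mem_stabilizer_of_forall {C : Set G} {g : G} (h : ∀ x ∈ C, x + g ∈ C) :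
    g ∈ AddAction.stabilizer G C := by
  rw [AddAction.mem_stabilizer_iff]
  have hs : g +ᵥ C ⊆ C := by
    rintro _ ⟨x, hx, rfl⟩
    simpa [add_comm] using h x hx
  refine Set.eq_of_subset_of_ncard_le hs ?_ (Set.toFinite C)
  exact (Set.ncard_image_of_injective C (add_right_injective g)).ge

theorem ncard_split (H : AddSubgroup G) (p : G → Prop) :
    {x : G | x ∈ H ∧ p x}.ncard + {x : G | x ∈ H ∧ ¬ p x}.ncard = Nat.card H := by
  rw [← Set.ncard_union_eq]
  · have : {x : G | x ∈ H ∧ p x} ∪ {x : G | x ∈ H ∧ ¬ p x} = (H : Set G) := by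
      ext x; by_cases h : p x <;> simp [h]
    rw [this]; rfl
  · rw [Set.disjoint_left]; rintro x h h'; exact h'.2 h.2

theorem card_inf_le_ncard (H₁ H₂ : AddSubgroup G) {P : Set G} {x : G} (hx : x ∈ P)
    (hP : ∀ x ∈ P, ∀ g ∈ H₁ ⊓ H₂, x + g ∈ P) :
    Nat.card (H₁ ⊓ H₂ : AddSubgroup G) ≤ P.ncard := by
  have : Nat.card (H₁ ⊓ H₂ : AddSubgroup G) = ((fun g => x + g) '' ((H₁ ⊓ H₂ : AddSubgroup G) : Set G)).ncard :=
    (Set.ncard_image_of_injective _ (add_right_injective x)).symm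
  rw [this]
  refine Set.ncard_le_ncard ?_ (Set.toFinite P)
  rintro _ ⟨g, hg, rfl⟩
  exact hP x hx g hg

theorem ncard_sdiff_of_mem_sdiff {C₁ C₂ : Set G} {c : G} (hc : c ∈ C₂ \ C₁) :
    let H₁ := AddAction.stabilizer G C₁
    let H₂ := AddAction.stabilizer G C₂
    let h := Nat.card (H₁ ⊓ H₂ : AddSubgroup G)
    Nat.card H₁ ≤ (C₂ \ C₁).ncard + h ∨ Nat.card H₂ ≤ (C₁ \ C₂).ncard + h ∨
      Nat.card H₂ ≤ (C₂ \ C₁).ncard := by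
  intro H₁ H₂ h
  have hpos : 0 < h := Nat.card_pos
  have s₁ : ∀ g ∈ H₁, ∀ x, x + g ∈ C₁ ↔ x ∈ C₁ := fun g hg x => add_mem_iff_of_mem_stabilizer hg x
  have s₂ : ∀ g ∈ H₂, ∀ x, x + g ∈ C₂ ↔ x ∈ C₂ := fun g hg x => add_mem_iff_of_mem_stabilizer hg x
  have ex := ncard_split H₂ (fun p => c + p ∈ C₁)
  have ey := ncard_split H₁ (fun q => c + q ∈ C₂)
  have m1 := ncard_mul_ncard_le_card_inf H₁ H₂ (P := {p | p ∈ H₂ ∧ c + p ∈ C₁})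
    (Q := {q | q ∈ H₁ ∧ ¬ c + q ∈ C₂}) (D := C₁ \ C₂) (fun p hp => hp.1) (fun q hq => hq.1) c
    (fun p hp q hq => ⟨(s₁ q hq.1 _).2 hp.2, by
      rw [add_right_comm, s₂ p hp.1]; exact hq.2⟩)
  have m2 := ncard_mul_ncard_le_card_inf H₁ H₂ (P := {p | p ∈ H₂ ∧ ¬ c + p ∈ C₁})
    (Q := {q | q ∈ H₁ ∧ c + q ∈ C₂}) (D := C₂ \ C₁) (fun p hp => hp.1) (fun q hq => hq.1) c
    (fun p hp q hq => ⟨by rw [add_right_comm, s₂ p hp.1]; exact hq.2, by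
      rw [s₁ q hq.1]; exact hp.2⟩)
  have x' : h ≤ {p | p ∈ H₂ ∧ ¬ c + p ∈ C₁}.ncard := by
    refine card_inf_le_ncard H₁ H₂ (x := 0) ⟨H₂.zero_mem, by simpa using hc.2⟩ ?_
    rintro x hx g hg
    exact ⟨H₂.add_mem hx.1 hg.2, by rw [← add_assoc, s₁ g hg.1]; exact hx.2⟩
  have y' : h ≤ {q | q ∈ H₁ ∧ c + q ∈ C₂}.ncard := by
    refine card_inf_le_ncard H₁ H₂ (x := 0) ⟨H₁.zero_mem, by simpa using hc.1⟩ ?_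
    rintro x hx g hg
    exact ⟨H₁.add_mem hx.1 hg.1, by rw [← add_assoc, s₂ g hg.2]; exact hx.2⟩
  have hx : {p | p ∈ H₂ ∧ c + p ∈ C₁}.ncard = 0 ∨ h ≤ {p | p ∈ H₂ ∧ c + p ∈ C₁}.ncard := by
    rcases Set.eq_empty_or_nonempty {p | p ∈ H₂ ∧ c + p ∈ C₁} with e | ⟨x, hx⟩
    · left; rw [e]; simp
    · right
      refine card_inf_le_ncard H₁ H₂ hx ?_
      rintro x hx g hg
      exact ⟨H₂.add_mem hx.1 hg.2, by rw [← add_assoc, s₁ g hg.1]; exact hx.2⟩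
  have hy : {q | q ∈ H₁ ∧ ¬ c + q ∈ C₂}.ncard = 0 ∨ h ≤ {q | q ∈ H₁ ∧ ¬ c + q ∈ C₂}.ncard := by
    rcases Set.eq_empty_or_nonempty {q | q ∈ H₁ ∧ ¬ c + q ∈ C₂} with e | ⟨x, hx⟩
    · left; rw [e]; simp
    · right
      refine card_inf_le_ncard H₁ H₂ hx ?_
      rintro x hx g hg
      exact ⟨H₁.add_mem hx.1 hg.1, by rw [← add_assoc, s₂ g hg.2]; exact hx.2⟩
  change _ ≤ h * _ at m1 m2
  generalize {p | p ∈ H₂ ∧ c + p ∈ C₁}.ncard = x at *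
  generalize {p | p ∈ H₂ ∧ ¬ c + p ∈ C₁}.ncard = x₁ at *
  generalize {q | q ∈ H₁ ∧ c + q ∈ C₂}.ncard = y₁ at *
  generalize {q | q ∈ H₁ ∧ ¬ c + q ∈ C₂}.ncard = y at *
  generalize (C₁ \ C₂).ncard = u at *
  generalize (C₂ \ C₁).ncard = v at *
  clear_value h
  rw [← ex, ← ey]
  rcases hx with hx | hx
  · right; right
    subst hx
    have : h * x₁ ≤ h * v := le_trans (by rw [mul_comm]; exact Nat.mul_le_mul_left _ y') m2
    have := Nat.le_of_mul_le_mul_left this hpos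
    omega
  rcases hy with hy | hy
  · left
    subst hy
    have : h * y₁ ≤ h * v := le_trans (Nat.mul_le_mul_right _ x') m2
    have := Nat.le_of_mul_le_mul_left this hpos
    omega
  by_contra! hcon
  obtain ⟨h1, h2, -⟩ := hcon
  zify at *
  have a1 : x * y + h * h < h * (x + x₁) := by nlinarith
  have a2 : x₁ * y₁ + h * h < h * (y₁ + y) := by nlinarith
  nlinarith [mul_nonneg (sub_nonneg.2 hx) (sub_nonneg.2 hy),
    mul_nonneg (sub_nonneg.2 x') (sub_nonneg.2 y')]

theorem le_ncard_union_add_card_stabilizer {C₁ C₂ : Set G} {N : ℕ}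
    (h₁ : N ≤ C₁.ncard + Nat.card (AddAction.stabilizer G C₁))
    (h₂ : N ≤ C₂.ncard + Nat.card (AddAction.stabilizer G C₂)) :
    N ≤ (C₁ ∪ C₂).ncard + Nat.card (AddAction.stabilizer G (C₁ ∪ C₂)) := by
  by_cases h12 : C₁ ⊆ C₂
  · rwa [Set.union_eq_self_of_subset_left h12]
  by_cases h21 : C₂ ⊆ C₁
  · rwa [Set.union_eq_self_of_subset_right h21]
  obtain ⟨c, hc, hc'⟩ := Set.not_subset.1 h12
  obtain ⟨d, hd, hd'⟩ := Set.not_subset.1 h21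
  have k1 := ncard_sdiff_of_mem_sdiff (C₁ := C₁) (C₂ := C₂) ⟨hd, hd'⟩
  have k2 := ncard_sdiff_of_mem_sdiff (C₁ := C₂) (C₂ := C₁) ⟨hc, hc'⟩
  have hst : Nat.card (AddAction.stabilizer G C₁ ⊓ AddAction.stabilizer G C₂ : AddSubgroup G) ≤
      Nat.card (AddAction.stabilizer G (C₁ ∪ C₂)) := by
    refine AddSubgroup.card_le_of_le (fun g hg => ?_)
    apply mem_stabilizer_of_forall
    rintro x (hx | hx)
    · exact Or.inl ((add_mem_iff_of_mem_stabilizer hg.1 x).2 hx)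
    · exact Or.inr ((add_mem_iff_of_mem_stabilizer hg.2 x).2 hx)
  have e1 : (C₁ ∪ C₂).ncard = C₁.ncard + (C₂ \ C₁).ncard := by
    rw [← Set.union_sdiff_self, Set.ncard_union_eq Set.disjoint_sdiff_right]
  have e2 : (C₁ ∪ C₂).ncard = C₂.ncard + (C₁ \ C₂).ncard := by
    rw [Set.union_comm, ← Set.union_sdiff_self, Set.ncard_union_eq Set.disjoint_sdiff_right]
  simp only at k1 k2
  rw [inf_comm] at k2
  omega

theorem exists_subset_add_card_stabilizer (n : ℕ) (A B : Set G) (hn : B.ncard = n) {b₀ : G}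
    (hb₀ : b₀ ∈ B) : ∃ C : Set G, b₀ +ᵥ A ⊆ C ∧ C ⊆ A + B ∧
      A.ncard + B.ncard ≤ C.ncard + Nat.card (AddAction.stabilizer G C) := by
  induction n using Nat.strong_induction_on generalizing A B with
  | _ n ih =>
  by_cases hst : ∀ a ∈ A, ∀ b ∈ B, a + (b - b₀) ∈ A
  · refine ⟨b₀ +ᵥ A, subset_rfl, ?_, ?_⟩
    · rintro _ ⟨a, ha, rfl⟩
      exact ⟨a, ha, b₀, hb₀, by simp [add_comm]⟩
    · have e1 : (b₀ +ᵥ A).ncard = A.ncard :=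
        Set.ncard_image_of_injective A (add_right_injective b₀)
      have e2 : B.ncard ≤ Nat.card (AddAction.stabilizer G (b₀ +ᵥ A)) := by
        rw [← Set.ncard_image_of_injective B (sub_left_injective (b := b₀))]
        refine Set.ncard_le_ncard (t := (AddAction.stabilizer G (b₀ +ᵥ A) : Set G)) ?_
        rintro _ ⟨b, hb, rfl⟩
        apply mem_stabilizer_of_forall
        rintro _ ⟨a, ha, rfl⟩
        exact ⟨a + (b - b₀), hst a ha b hb, by simp [add_assoc]⟩
      omega
  · push Not at hst
    obtain ⟨a, ha, b, hb, hab⟩ := hst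
    set e := a - b₀ with he
    set B₁ := {x | x ∈ B ∧ x + e ∈ A} with hB₁
    set B₂ := {x | x ∈ B ∧ x + e ∉ A} with hB₂
    have hBe : B.ncard = B₁.ncard + B₂.ncard := by
      rw [← Set.ncard_union_eq]
      · congr 1; ext x; by_cases h : x + e ∈ A <;> simp [hB₁, hB₂, h]
      · rw [Set.disjoint_left]; rintro x h h'; exact h'.2 h.2
    have hb2 : 0 < B₂.ncard := by
      rw [Set.ncard_pos]
      exact ⟨b, hb, by rwa [show b + e = a + (b - b₀) by rw [he]; abel]⟩
    have hA1 : (A ∪ (fun x => x + e) '' B₂).ncard = A.ncard + B₂.ncard := by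
      rw [Set.ncard_union_eq, Set.ncard_image_of_injective B₂ (add_left_injective e)]
      rw [Set.disjoint_left]
      rintro _ hx ⟨y, hy, rfl⟩
      exact hy.2 hx
    obtain ⟨C, h1, h2, h3⟩ := ih B₁.ncard (by omega) (A ∪ (fun x => x + e) '' B₂) B₁ rfl
      ⟨hb₀, by simpa [he] using ha⟩
    refine ⟨C, (Set.vadd_set_mono Set.subset_union_left).trans h1, h2.trans ?_, by omega⟩
    rintro _ ⟨x, hx | ⟨y, hy, rfl⟩, z, hz, rfl⟩
    · exact ⟨x, hx, z, hz.1, rfl⟩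
    · exact ⟨z + e, hz.2, y, hy.1, by simp only; abel⟩

/-- A weak form of Kneser's theorem in a finite abelian group. -/
theorem ncard_add_ncard_le_ncard_add_card_stabilizer (A : Set G) {B : Set G} (hB : B.Nonempty) :
    A.ncard + B.ncard ≤ (A + B).ncard + Nat.card (AddAction.stabilizer G (A + B)) := by
  choose C h1 h2 h3 using fun b : B => exists_subset_add_card_stabilizer _ A B rfl b.2
  have key : ∀ s : Set B, s.Finite → s.Nonempty → A.ncard + B.ncard ≤
      (⋃ b ∈ s, C b).ncard + Nat.card (AddAction.stabilizer G (⋃ b ∈ s, C b)) := by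
    intro s hs
    induction s, hs using Set.Finite.induction_on with
    | empty => simp
    | @insert b s _ _ ih =>
      intro _
      rcases s.eq_empty_or_nonempty with rfl | hne
      · simpa using h3 b
      · rw [Set.biUnion_insert]
        exact le_ncard_union_add_card_stabilizer (h3 b) (ih hne)
  have hU : (⋃ b ∈ (Set.univ : Set B), C b) = A + B := by
    apply Set.Subset.antisymm
    · exact Set.iUnion₂_subset fun b _ => h2 b
    · rintro _ ⟨a, ha, b, hb, rfl⟩
      exact Set.mem_biUnion (Set.mem_univ (⟨b, hb⟩ : B))
        (h1 ⟨b, hb⟩ ⟨a, ha, by simp [add_comm]⟩)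
  rw [← hU]
  exact key _ Set.finite_univ ⟨⟨_, hB.some_mem⟩, trivial⟩

end FiniteKneser

section Density

variable {G : Type*} [AddCommGroup G]

/-- A translation-invariant finitely additive probability measure on all subsets of `G`. -/
structure IsInvariantDensity (l : Set G → ℝ) : Prop where
  nonneg : ∀ A, 0 ≤ l A
  univ : l Set.univ = 1
  union : ∀ A B, Disjoint A B → l (A ∪ B) = l A + l B
  vadd : ∀ (g : G) A, l (g +ᵥ A) = l A

namespace IsInvariantDensity

variable {l : Set G → ℝ} (hl : IsInvariantDensity l)
include hl

theorem empty : l ∅ = 0 := by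
  have := hl.union ∅ ∅ (by simp)
  simp at this
  exact this

theorem inter_add_sdiff (A B : Set G) : l (A ∩ B) + l (A \ B) = l A := by
  rw [← hl.union _ _ (Set.disjoint_left.2 fun x h h' => h'.2 h.2), Set.inter_union_sdiff]

theorem mono {A B : Set G} (h : A ⊆ B) : l A ≤ l B := by
  have := hl.inter_add_sdiff B A
  rw [Set.inter_eq_self_of_subset_right h] at this
  linarith [hl.nonneg (B \ A)]

theorem sdiff_of_subset {A B : Set G} (h : A ⊆ B) : l (B \ A) = l B - l A := by
  have := hl.inter_add_sdiff B A
  rw [Set.inter_eq_self_of_subset_right h] at this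
  linarith

theorem union_add_inter (A B : Set G) : l (A ∪ B) + l (A ∩ B) = l A + l B := by
  have h1 := hl.inter_add_sdiff A B
  have h2 := hl.union (A \ B) B Set.disjoint_sdiff_left
  rw [Set.sdiff_union_self] at h2
  linarith

theorem le_one (A : Set G) : l A ≤ 1 := hl.univ ▸ hl.mono (Set.subset_univ A)

theorem compl (A : Set G) : l Aᶜ = 1 - l A := by
  have := hl.union A Aᶜ disjoint_compl_right
  rw [Set.union_compl_self, hl.univ] at this
  linarith

theorem le_of_sdiff_eq_zero {A B : Set G} (h : l (A \ B) = 0) : l A ≤ l B := by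
  have := hl.inter_add_sdiff A B
  linarith [hl.mono (Set.inter_subset_right (s := A) (t := B))]

theorem union_le (A B : Set G) : l (A ∪ B) ≤ l A + l B := by
  linarith [hl.union_add_inter A B, hl.nonneg (A ∩ B)]

theorem add_le_of_disjoint {A B C : Set G} (hA : A ⊆ C) (hB : B ⊆ C) (h : Disjoint A B) :
    l A + l B ≤ l C := by
  rw [← hl.union _ _ h]
  exact hl.mono (Set.union_subset hA hB)

theorem le_add_right {A B : Set G} {b : G} (hb : b ∈ B) : l A ≤ l (A + B) := by
  rw [← hl.vadd b A]
  apply hl.mono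
  rintro _ ⟨a, ha, rfl⟩
  exact ⟨a, ha, b, hb, by simp [add_comm]⟩

theorem le_add_left {A B : Set G} {a : G} (ha : a ∈ A) : l B ≤ l (A + B) := by
  rw [add_comm]; exact hl.le_add_right ha

/-- `A ↦ l (A + B)` is submodular. -/
theorem submodular (A A' B : Set G) :
    l (A ∩ A' + B) + l (A ∪ A' + B) ≤ l (A + B) + l (A' + B) := by
  rw [Set.union_add, ← hl.union_add_inter (A + B) (A' + B)]
  linarith [hl.mono (Set.inter_add_subset (s₁ := A) (s₂ := A') (t := B))]

variable (H : AddSubgroup G)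

theorem inter_preimage_finset (S : Set G) (s : Finset (G ⧸ H)) :
    l (S ∩ (QuotientAddGroup.mk : G → G ⧸ H) ⁻¹' s) =
      ∑ q ∈ s, l (S ∩ (QuotientAddGroup.mk : G → G ⧸ H) ⁻¹' {q}) := by
  classical
  induction s using Finset.induction_on with
  | empty => simp [hl.empty]
  | insert a s ha ih =>
    rw [Finset.sum_insert ha, ← ih, ← hl.union]
    · rw [← Set.inter_union_distrib_left, ← Set.preimage_union, Finset.coe_insert, Set.insert_eq]
    · rw [Set.disjoint_left]
      rintro x ⟨_, hx⟩ ⟨_, hx'⟩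
      simp only [Set.mem_preimage, Set.mem_singleton_iff] at hx hx'
      rw [hx] at hx'
      exact ha hx'

omit hl in
theorem preimage_mk_singleton (g : G) :
    (QuotientAddGroup.mk : G → G ⧸ H) ⁻¹' {(g : G ⧸ H)} = g +ᵥ (H : Set G) := by
  ext x
  rw [Set.mem_preimage, Set.mem_singleton_iff, eq_comm, QuotientAddGroup.eq,
    Set.mem_vadd_set_iff_neg_vadd_mem]
  rfl

theorem preimage_singleton (q : G ⧸ H) :
    l ((QuotientAddGroup.mk : G → G ⧸ H) ⁻¹' {q}) = l H := by
  obtain ⟨g, rfl⟩ := QuotientAddGroup.mk_surjective q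
  rw [preimage_mk_singleton, hl.vadd]

theorem preimage_mk {F : Set (G ⧸ H)} (hF : F.Finite) :
    l ((QuotientAddGroup.mk : G → G ⧸ H) ⁻¹' F) = F.ncard * l H := by
  lift F to Finset (G ⧸ H) using hF
  have := hl.inter_preimage_finset H Set.univ F
  simp only [Set.univ_inter, hl.preimage_singleton] at this
  simp [this]

theorem ncard_mul_le {F : Set (G ⧸ H)} (hF : F.Finite) {S : Set G} {p : ℝ}
    (h : ∀ q ∈ F, p ≤ l (S ∩ (QuotientAddGroup.mk : G → G ⧸ H) ⁻¹' {q})) :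
    F.ncard * p ≤ l S := by
  lift F to Finset (G ⧸ H) using hF
  have := hl.inter_preimage_finset H S F
  have h2 := Finset.card_nsmul_le_sum F _ p h
  rw [← this, nsmul_eq_mul] at h2
  rw [Set.ncard_coe_finset]
  exact h2.trans (hl.mono Set.inter_subset_left)

theorem le_ncard_mul {F : Set (G ⧸ H)} (hF : F.Finite) {S : Set G} {p : ℝ}
    (hS : ∀ x ∈ S, (x : G ⧸ H) ∈ F)
    (h : ∀ q ∈ F, l (S ∩ (QuotientAddGroup.mk : G → G ⧸ H) ⁻¹' {q}) ≤ p) :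
    l S ≤ F.ncard * p := by
  lift F to Finset (G ⧸ H) using hF
  have := hl.inter_preimage_finset H S F
  have h2 := Finset.sum_le_card_nsmul F _ p h
  rw [← this, nsmul_eq_mul, Set.inter_eq_self_of_subset_left
    (show S ⊆ (QuotientAddGroup.mk : G → G ⧸ H) ⁻¹' F from hS)] at h2
  rwa [Set.ncard_coe_finset]

theorem finiteIndex_of_pos (h : 0 < l H) : H.FiniteIndex := by
  by_contra hfin
  have hinf : Infinite (G ⧸ H) :=
    not_finite_iff_infinite.1 fun _ => hfin AddSubgroup.finiteIndex_of_finite_quotient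
  obtain ⟨n, hn⟩ := exists_nat_gt (1 / l H)
  obtain ⟨s, hs⟩ := Infinite.exists_subset_card_eq (G ⧸ H) n
  have := hl.preimage_mk H s.finite_toSet
  rw [Set.ncard_coe_finset, hs] at this
  have h1 := hl.le_one ((QuotientAddGroup.mk : G → G ⧸ H) ⁻¹' s)
  rw [div_lt_iff₀ h] at hn
  linarith

theorem index_mul [H.FiniteIndex] : H.index * l H = 1 := by
  have : Finite (G ⧸ H) := AddSubgroup.finite_quotient_of_finiteIndex
  have := hl.preimage_mk H (Set.finite_univ)
  rw [Set.preimage_univ, hl.univ, Set.ncard_univ] at this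
  exact this.symm

theorem pos [H.FiniteIndex] : 0 < l H := by
  have := hl.index_mul H
  rcases (hl.nonneg H).eq_or_lt with h | h
  · rw [← h] at this; simp at this
  · exact h

theorem eq_of_finiteIndex {m : Set G → ℝ} (hm : IsInvariantDensity m) [H.FiniteIndex] :
    l H = m H := by
  have h1 := hl.index_mul H
  have h2 := hm.index_mul H
  have : (H.index : ℝ) ≠ 0 := by rintro h; rw [h] at h1; simp at h1
  exact mul_left_cancel₀ this (h1.trans h2.symm)

omit hl in
theorem add_subgroup_eq_preimage (B : Set G) :
    B + (H : Set G) =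
      (QuotientAddGroup.mk : G → G ⧸ H) ⁻¹' ((QuotientAddGroup.mk : G → G ⧸ H) '' B) := by
  ext x
  simp only [Set.mem_preimage, Set.mem_image]
  constructor
  · rintro ⟨b, hb, h, hh, rfl⟩
    exact ⟨b, hb, by rw [QuotientAddGroup.eq]; simpa using hh⟩
  · rintro ⟨b, hb, h⟩
    exact ⟨b, hb, -b + x, QuotientAddGroup.eq.1 h, by simp⟩

theorem preimage_sub_mk [H.FiniteIndex] (z : G ⧸ H) (F : Set (G ⧸ H)) :
    l ((QuotientAddGroup.mk : G → G ⧸ H) ⁻¹' {q | z - q ∈ F}) =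
      l ((QuotientAddGroup.mk : G → G ⧸ H) ⁻¹' F) := by
  have : Finite (G ⧸ H) := AddSubgroup.finite_quotient_of_finiteIndex
  rw [hl.preimage_mk H (Set.toFinite _), hl.preimage_mk H (Set.toFinite _)]
  congr 2
  rw [← Set.ncard_image_of_injective F (sub_right_injective (b := z))]
  congr 1
  ext q
  constructor
  · intro h; exact ⟨z - q, h, by simp⟩
  · rintro ⟨f, hf, rfl⟩; simpa using hf

theorem neg_add_subgroup [H.FiniteIndex] (B : Set G) :
    l (-B + (H : Set G)) = l (B + (H : Set G)) := by
  rw [add_subgroup_eq_preimage, add_subgroup_eq_preimage, ← hl.preimage_sub_mk H 0]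
  congr 2
  ext q
  simp only [Set.mem_ofPred_eq, zero_sub, Set.mem_image, Set.mem_neg]
  constructor
  · rintro ⟨b, hb, rfl'⟩
    exact ⟨-b, hb, by rw [QuotientAddGroup.mk_neg, rfl', neg_neg]⟩
  · rintro ⟨b, hb, rfl⟩
    exact ⟨-b, by simpa using hb, by simp⟩

end IsInvariantDensity

/-- The invariant density `m` only sees the average of `t ↦ l (X ∩ (t + Y))`. -/
structure IsMixing (l m : Set G → ℝ) : Prop where
  vadd : ∀ (X Y T : Set G) (p : ℝ), (∀ t ∈ T, p ≤ l (X ∩ (t +ᵥ Y))) → p * m T ≤ l X * l Y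
  neg_vadd : ∀ (X Y T : Set G) (p : ℝ), (∀ t ∈ T, p ≤ l (X ∩ (-t +ᵥ Y))) → p * m T ≤ l X * l Y

namespace IsMixing

variable {l m : Set G → ℝ} (hmix : IsMixing l m)
include hmix

theorem le_add {X : Set G} (hX : 0 < l X) (B : Set G) : m B ≤ l (X + B) := by
  have := hmix.neg_vadd X (X + B) B (l X) (fun b hb => by
    rw [Set.inter_eq_self_of_subset_left]
    intro x hx
    exact ⟨x + b, ⟨x, hx, b, hb, rfl⟩, by simp [add_comm]⟩)
  exact le_of_mul_le_mul_left this hX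

theorem le_add_neg {X : Set G} (hX : 0 < l X) (B : Set G) : m B ≤ l (X + -B) := by
  have := hmix.vadd X (X + -B) B (l X) (fun b hb => by
    rw [Set.inter_eq_self_of_subset_left]
    intro x hx
    exact ⟨x + -b, ⟨x, hx, -b, by simpa using hb, rfl⟩, by simp⟩)
  exact le_of_mul_le_mul_left this hX

theorem mul_le (hl : IsInvariantDensity l) (hm : IsInvariantDensity m) {X Y T : Set G} {q : ℝ}
    (h : ∀ t ∉ T, l (X ∩ (t +ᵥ Y)) ≤ q) (hq : 0 ≤ q) : l X * l Y ≤ l X * m T + q := by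
  have := hmix.vadd X Yᶜ Tᶜ (l X - q) (fun t ht => by
    rw [Set.vadd_set_compl, ← Set.sdiff_eq]
    linarith [hl.inter_add_sdiff X (t +ᵥ Y), h t ht])
  rw [hl.compl, hm.compl] at this
  nlinarith [hm.nonneg T]

end IsMixing

end Density

section Atom

variable {G : Type*} [AddCommGroup G]

/-- `X` is a non-null subset of `H₀` whose sumset with `B` is smaller than `H₀`. -/
structure IsAdmissible (l : Set G → ℝ) (H₀ : AddSubgroup G) (B X : Set G) : Prop where
  subset : X ⊆ H₀
  pos : 0 < l X
  lt : l (X + B) < l H₀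

variable {l m : Set G → ℝ} (hl : IsInvariantDensity l)
include hl

omit hl in
theorem add_subset_subgroup {H₀ : AddSubgroup G} {X D : Set G} (hX : X ⊆ H₀) (hD : D ⊆ H₀) :
    X + D ⊆ H₀ := by
  rintro _ ⟨x, hx, d, hd, rfl⟩
  exact H₀.add_mem (hX hx) (hD hd)

omit hl in
theorem vadd_set_add (g : G) (X D : Set G) : (g +ᵥ X) + D = g +ᵥ (X + D) := by
  simp only [← Set.singleton_vadd, vadd_eq_add, add_assoc]

theorem density_dual_add_le {H₀ : AddSubgroup G} {D X : Set G} (hX : X ⊆ H₀) (hD : D ⊆ H₀) :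
    l ((H₀ : Set G) \ (X + D) + -D) ≤ l H₀ - l X := by
  have : l ((H₀ : Set G) \ (X + D) + -D) + l X ≤ l H₀ := by
    refine hl.add_le_of_disjoint ?_ hX ?_
    · refine add_subset_subgroup Set.sdiff_subset ?_
      intro d hd
      simpa using H₀.neg_mem (hD hd)
    · rw [Set.disjoint_left]
      rintro _ ⟨c, hc, d, hd, rfl⟩ hx
      exact hc.2 ⟨c + d, hx, -d, hd, by simp⟩
  linarith

theorem IsAdmissible.dual {H₀ : AddSubgroup G} {D X : Set G} (hX : IsAdmissible l H₀ D X)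
    (hD : D ⊆ H₀) : IsAdmissible l H₀ (-D) ((H₀ : Set G) \ (X + D)) where
  subset := Set.sdiff_subset
  pos := by
    rw [hl.sdiff_of_subset (add_subset_subgroup hX.subset hD)]
    linarith [hX.lt]
  lt := by linarith [density_dual_add_le hl hX.subset hD, hX.pos]

theorem inter_vadd_dichotomy {H₀ : AddSubgroup G} {D X : Set G} {β σ : ℝ}
    (hX : IsAdmissible l H₀ D X) (hD : D ⊆ H₀) (hDne : D.Nonempty) (hσ : 0 < σ) (hσ1 : σ ≤ 1)
    (hmax : ∀ X', IsAdmissible l H₀ D X' →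
      l X' + β - l (X' + D) + σ / 3 * (l H₀ - l X') ^ 2 ≤
        l X + β - l (X + D) + σ / 3 * (l H₀ - l X) ^ 2 + σ / 3 * σ ^ 2 * l H₀ / 3)
    (hmax' : ∀ X', IsAdmissible l H₀ (-D) X' →
      l X' + β - l (X' + -D) + σ / 3 * (l H₀ - l X') ^ 2 ≤
        l X + β - l (X + D) + σ / 3 * (l H₀ - l X) ^ 2 + σ / 3 * σ ^ 2 * l H₀ / 3)
    {g : G} (hg : g ∈ H₀) :
    l (X ∩ (g +ᵥ X)) ≤ σ ∨ l X - l (X ∩ (g +ᵥ X)) ≤ σ := by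
  have hw1 := hl.le_one (H₀ : Set G)
  have hXw := hl.mono hX.subset
  have hXpos := hX.pos
  have hdual := hmax' _ (hX.dual hl hD)
  have hCle := density_dual_add_le hl hX.subset hD
  rw [hl.sdiff_of_subset (add_subset_subgroup hX.subset hD)] at hdual
  obtain ⟨d, hd⟩ := hDne
  have hXD := hl.le_add_right (A := X) hd
  have hgX : l ((g +ᵥ X) + D) = l (X + D) := by rw [vadd_set_add, hl.vadd]
  have hsub := hl.submodular X (g +ᵥ X) D
  have hUI := hl.union_add_inter X (g +ᵥ X)
  rw [hl.vadd] at hUI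
  have hUH : X ∪ (g +ᵥ X) ⊆ H₀ := by
    refine Set.union_subset hX.subset ?_
    rintro _ ⟨x, hx, rfl⟩
    exact H₀.add_mem hg (hX.subset hx)
  have hUpos : 0 < l (X ∪ (g +ᵥ X)) := hXpos.trans_le (hl.mono Set.subset_union_left)
  have hIle : l (X ∩ (g +ᵥ X)) ≤ l X := hl.mono Set.inter_subset_left
  have hIlt : l (X ∩ (g +ᵥ X) + D) < l H₀ :=
    (hl.mono (Set.add_subset_add_right Set.inter_subset_left)).trans_lt hX.lt
  rw [hgX] at hsub
  generalize hI : X ∩ (g +ᵥ X) = I at *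
  generalize hU : X ∪ (g +ᵥ X) = U at *
  by_cases hIpos : 0 < l I
  swap
  · left; linarith
  have hmI := hmax I ⟨hI ▸ Set.inter_subset_left.trans hX.subset, hIpos, hIlt⟩
  have hprod : 0 < σ * σ := by positivity
  by_cases hUlt : l (U + D) < l H₀
  · right
    have hmU := hmax U ⟨hUH, hUpos, hUlt⟩
    have hUeq : l U = 2 * l X - l I := by linarith
    rw [hUeq] at hmU
    have hs : σ / 3 * (2 * (l X - l I) ^ 2) ≤ 2 * (σ / 3 * σ ^ 2 * l H₀ / 3) := by nlinarith
    have hs2 : (l X - l I) ^ 2 ≤ σ ^ 2 := by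
      have h3 : (σ / 3) * ((l X - l I) ^ 2) ≤ (σ / 3) * σ ^ 2 := by
        have h4 : σ / 3 * σ ^ 2 * l H₀ ≤ σ / 3 * σ ^ 2 :=
          mul_le_of_le_one_right (by positivity) hw1
        have h5 : 0 < σ / 3 * σ ^ 2 := by positivity
        linarith
      exact le_of_mul_le_mul_left h3 (by positivity)
    exact abs_le_of_sq_le_sq' hs2 hσ.le |>.2
  · left
    have h1 : l X - (l H₀ - l (X + D)) ≤ σ ^ 2 / 3 := by
      by_contra! hcon
      have h2 : σ / 3 * (l (X + D) ^ 2 - (l H₀ - l X) ^ 2) ≤ σ / 3 * (σ ^ 2 * l H₀ / 3) := by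
        have e : l H₀ - (l H₀ - l (X + D)) = l (X + D) := by ring
        rw [e] at hdual
        linarith
      have h3 := le_of_mul_le_mul_left h2 (by positivity)
      have h5 : 0 < l H₀ := by linarith
      have h6 : (l X - (l H₀ - l (X + D))) * l H₀ ≤
          (l X - (l H₀ - l (X + D))) * (l (X + D) + (l H₀ - l X)) :=
        mul_le_mul_of_nonneg_left (by linarith) (by nlinarith)
      have h7 := mul_lt_mul_of_pos_right hcon h5
      linarith
    have h4 : (l H₀ - l X) ^ 2 ≤ 1 := by nlinarith
    have h5 : σ ^ 2 ≤ σ := by nlinarith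
    have h6 : σ / 3 * σ ^ 2 * l H₀ / 3 ≤ σ / 9 := by
      have : σ ^ 2 * l H₀ ≤ 1 := by nlinarith
      nlinarith
    have h7 : σ / 3 * (l H₀ - l X) ^ 2 ≤ σ / 3 := by nlinarith
    have h8 : 0 ≤ σ / 3 * (l H₀ - l I) ^ 2 := by positivity
    linarith

theorem exists_approximate_stabilizer {H₀ : AddSubgroup G} {X : Set G} {σ : ℝ} (hX : X ⊆ H₀)
    (hσ : 0 ≤ σ) (hσX : 3 * σ < l X)
    (hdich : ∀ g ∈ H₀, l (X ∩ (g +ᵥ X)) ≤ σ ∨ l X - l (X ∩ (g +ᵥ X)) ≤ σ) :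
    ∃ H ≤ H₀, (∀ g ∈ H, l X - l (X ∩ (g +ᵥ X)) ≤ σ) ∧ ∀ g ∉ H, l (X ∩ (g +ᵥ X)) ≤ σ := by
  refine ⟨{ carrier := {g | g ∈ H₀ ∧ l X - l (X ∩ (g +ᵥ X)) ≤ σ}
            zero_mem' := ⟨H₀.zero_mem, by simpa using hσ⟩
            add_mem' := ?_
            neg_mem' := ?_ }, fun g hg => hg.1, fun g hg => hg.2, fun g hg => ?_⟩
  · rintro g h ⟨hg, hg'⟩ ⟨hh, hh'⟩
    refine ⟨H₀.add_mem hg hh, ?_⟩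
    refine (hdich _ (H₀.add_mem hg hh)).resolve_left fun hle => ?_
    have h1 := hl.inter_add_sdiff X (g +ᵥ X)
    have h2 := hl.inter_add_sdiff X (h +ᵥ X)
    have h3 := hl.inter_add_sdiff X ((g + h) +ᵥ X)
    have h4 : l (X \ ((g + h) +ᵥ X)) ≤ l (X \ (g +ᵥ X)) + l (g +ᵥ (X \ (h +ᵥ X))) := by
      refine (hl.mono ?_).trans (hl.union_le _ _)
      rw [Set.vadd_set_sdiff, vadd_vadd]
      intro x hx
      by_cases hxg : x ∈ g +ᵥ X
      · exact Or.inr ⟨hxg, hx.2⟩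
      · exact Or.inl ⟨hx.1, hxg⟩
    rw [hl.vadd] at h4
    linarith
  · rintro g ⟨hg, hg'⟩
    refine ⟨H₀.neg_mem hg, ?_⟩
    rwa [← hl.vadd g (X ∩ (-g +ᵥ X)), Set.vadd_set_inter, vadd_vadd, add_neg_cancel, zero_vadd, Set.inter_comm]
  · by_cases hgH : g ∈ H₀
    · exact (hdich g hgH).resolve_right fun h => hg ⟨hgH, h⟩
    · have : X ∩ (g +ᵥ X) = ∅ := by
        rw [Set.eq_empty_iff_forall_notMem]
        rintro _ ⟨hx, y, hy, rfl⟩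
        exact hgH ((H₀.add_mem_cancel_right (hX hy)).1 (hX hx))
      rw [this, hl.empty]
      exact hσ

theorem exists_almost_full_coset (hm : IsInvariantDensity m) (hmix : IsMixing l m)
    {H : AddSubgroup G} {X : Set G} {σ d : ℝ} (hσ : 0 < σ) (hd : 0 < d) (hdX : d ≤ l X)
    (hσd : σ ≤ d ^ 2 / 8) (hH : ∀ g ∈ H, l X - l (X ∩ (g +ᵥ X)) ≤ σ)
    (hH' : ∀ g ∉ H, l (X ∩ (g +ᵥ X)) ≤ σ) :
    H.FiniteIndex ∧ 7 / 8 * d ≤ l H ∧ l X ≤ l H + σ / d ∧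
      ∃ q : G ⧸ H, l H - 2 * σ ≤ l (X ∩ (QuotientAddGroup.mk : G → G ⧸ H) ⁻¹' {q}) := by
  have h1 := hmix.mul_le hl hm hH' hσ.le
  have hXpos : 0 < l X := hd.trans_le hdX
  have h2 : l X ≤ m H + σ / d := by
    have : l X * l X ≤ l X * (m H + σ / d) := by
      have : σ ≤ l X * (σ / d) := by
        rw [← mul_div_assoc, le_div_iff₀ hd]
        nlinarith
      linarith
    exact le_of_mul_le_mul_left this hXpos
  have h3 : σ / d ≤ d / 8 := by
    rw [div_le_iff₀ hd]
    linarith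
  have hfin : H.FiniteIndex := hm.finiteIndex_of_pos H (by linarith)
  have hfinite : Finite (G ⧸ H) := AddSubgroup.finite_quotient_of_finiteIndex
  rw [← hl.eq_of_finiteIndex H hm] at h2
  have hh : 7 / 8 * d ≤ l H := by linarith
  refine ⟨hfin, hh, h2, ?_⟩
  by_contra! hcon
  have hsmall : ∀ q : G ⧸ H, l (X ∩ (QuotientAddGroup.mk : G → G ⧸ H) ⁻¹' {q}) ≤ 2 * σ := by
    intro q
    have hlt := hcon q
    have ha := hl.nonneg (X ∩ (QuotientAddGroup.mk : G → G ⧸ H) ⁻¹' {q})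
    have hE := hmix.vadd (X ∩ (QuotientAddGroup.mk : G → G ⧸ H) ⁻¹' {q})
      (X ∩ (QuotientAddGroup.mk : G → G ⧸ H) ⁻¹' {q}) H
      (l (X ∩ (QuotientAddGroup.mk : G → G ⧸ H) ⁻¹' {q}) - σ) (fun t ht => by
        have e1 := hl.inter_add_sdiff (X ∩ (QuotientAddGroup.mk : G → G ⧸ H) ⁻¹' {q})
          (t +ᵥ (X ∩ (QuotientAddGroup.mk : G → G ⧸ H) ⁻¹' {q}))
        have e2 := hl.inter_add_sdiff X (t +ᵥ X)
        have e3 := hH t ht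
        have e4 : l ((X ∩ (QuotientAddGroup.mk : G → G ⧸ H) ⁻¹' {q}) \
            (t +ᵥ (X ∩ (QuotientAddGroup.mk : G → G ⧸ H) ⁻¹' {q}))) ≤ l (X \ (t +ᵥ X)) := by
          apply hl.mono
          rintro x ⟨⟨hx, hxq⟩, hx'⟩
          refine ⟨hx, ?_⟩
          rintro ⟨y, hy, rfl⟩
          refine hx' ⟨y, ⟨hy, ?_⟩, rfl⟩
          simp only [Set.mem_preimage, Set.mem_singleton_iff, vadd_eq_add,
            QuotientAddGroup.mk_add] at hxq ⊢
          rw [(QuotientAddGroup.eq_zero_iff t).2 ht, zero_add] at hxq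
          exact hxq
        linarith)
    rw [← hl.eq_of_finiteIndex H hm] at hE
    by_contra! h2σ
    nlinarith
  have h5 := hl.le_ncard_mul H (Set.finite_univ) (S := X) (fun _ _ => Set.mem_univ _)
    (fun q _ => hsmall q)
  rw [Set.ncard_univ] at h5
  have h6 := hl.index_mul H
  rw [AddSubgroup.index] at h6
  have h7 : l X * l H ≤ 2 * σ := by
    have := mul_le_mul_of_nonneg_right h5 (hl.nonneg H)
    nlinarith
  nlinarith [mul_le_mul hdX hh (by positivity) hXpos.le]

theorem ncard_mul_le_add {H : AddSubgroup G} [H.FiniteIndex] {X D : Set G} {p : ℝ} {q : G ⧸ H}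
    (hq : p ≤ l (X ∩ (QuotientAddGroup.mk : G → G ⧸ H) ⁻¹' {q})) :
    ((QuotientAddGroup.mk : G → G ⧸ H) '' D).ncard * p ≤ l (X + D) := by
  have : Finite (G ⧸ H) := AddSubgroup.finite_quotient_of_finiteIndex
  have hcard := Set.ncard_image_of_injective ((QuotientAddGroup.mk : G → G ⧸ H) '' D)
    (add_right_injective q)
  rw [← hcard]
  refine hl.ncard_mul_le H (Set.toFinite _) ?_
  rintro _ ⟨_, ⟨d, hd, rfl⟩, rfl⟩
  refine hq.trans ?_
  rw [← hl.vadd d]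
  apply hl.mono
  rintro _ ⟨x, ⟨hx, hxq⟩, rfl⟩
  refine ⟨⟨x, hx, d, hd, by simp [add_comm]⟩, ?_⟩
  simp only [Set.mem_preimage, Set.mem_singleton_iff, vadd_eq_add, QuotientAddGroup.mk_add]
    at hxq ⊢
  rw [hxq, add_comm]

/-- The largest value of `l X + β - l (X + B)` over admissible sets is nearly attained by a
finite-index subgroup. -/
theorem exists_subgroup_near_max (hm : IsInvariantDensity m) (hmix : IsMixing l m)
    {H₀ : AddSubgroup G} {A B : Set G} {β ε : ℝ} (hB : B ⊆ H₀) (hBne : B.Nonempty)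
    (hβ : ∀ X, 0 < l X → β ≤ l (X + B)) (hβ' : ∀ X, 0 < l X → β ≤ l (X + -B))
    (hA : IsAdmissible l H₀ B A) (hδ : 0 < l A + β - l (A + B)) (hε : 0 < ε) :
    ∃ H ≤ H₀, H.FiniteIndex ∧ l (B + (H : Set G)) < l H₀ ∧
      ∀ X, IsAdmissible l H₀ B X →
        l X + β - l (X + B) ≤ l H + β - l (B + (H : Set G)) + ε := by
  set d := (l A + β - l (A + B)) / 2 with hd
  have hdpos : 0 < d := by positivity
  have hd1 : d ≤ 1 := by linarith [hβ A hA.pos, hl.le_one A]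
  set σ := min (d ^ 2 / 8) (ε * d / 6) with hσ
  have hσpos : 0 < σ := by rw [hσ]; positivity
  have hσ1 : σ ≤ d ^ 2 / 8 := min_le_left _ _
  have hσ2 : σ ≤ ε * d / 6 := min_le_right _ _
  have hσle : σ ≤ d / 8 := by nlinarith
  have hw0 : 0 < l H₀ := hA.pos.trans_le (hl.mono hA.subset)
  have hw1 := hl.le_one (H₀ : Set G)
  obtain ⟨D, X, hDB, hX, hmax⟩ : ∃ D X, (D = B ∨ D = -B) ∧ IsAdmissible l H₀ D X ∧
      ∀ D' X', (D' = B ∨ D' = -B) → IsAdmissible l H₀ D' X' →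
      l X' + β - l (X' + D') + σ / 3 * (l H₀ - l X') ^ 2 ≤
        l X + β - l (X + D) + σ / 3 * (l H₀ - l X) ^ 2 + σ / 3 * σ ^ 2 * l H₀ / 3 := by
    let R : Set ℝ := {r | ∃ D X, (D = B ∨ D = -B) ∧ IsAdmissible l H₀ D X ∧
      r = l X + β - l (X + D) + σ / 3 * (l H₀ - l X) ^ 2}
    have hRne : R.Nonempty := ⟨_, B, A, Or.inl rfl, hA, rfl⟩
    have hRbdd : BddAbove R := by
      refine ⟨1 + β + σ / 3, ?_⟩
      rintro _ ⟨D, X, -, hX, rfl⟩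
      have h1 := hl.le_one X
      have h2 := hl.nonneg (X + D)
      have h3 : (l H₀ - l X) ^ 2 ≤ 1 := by
        have := hl.nonneg X
        have := hl.mono hX.subset
        nlinarith
      nlinarith
    have hε1 : 0 < σ / 3 * σ ^ 2 * l H₀ / 3 := by positivity
    obtain ⟨_, ⟨D, X, hD, hX, rfl⟩, hlt⟩ := exists_lt_of_lt_csSup hRne
      (show sSup R - σ / 3 * σ ^ 2 * l H₀ / 3 < sSup R by linarith)
    refine ⟨D, X, hD, hX, fun D' X' hD' hX' => ?_⟩
    linarith [le_csSup hRbdd ⟨D', X', hD', hX', rfl⟩]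
  have hnegB : -B ⊆ H₀ := fun b hb => by simpa using H₀.neg_mem (hB hb)
  have hD : D ⊆ H₀ := by rcases hDB with rfl | rfl <;> assumption
  have hDne : D.Nonempty := by rcases hDB with rfl | rfl <;> simpa using hBne
  have hnegD : -D = B ∨ -D = -B := by rcases hDB with rfl | rfl <;> simp
  have hβD : ∀ X, 0 < l X → β ≤ l (X + D) := by rcases hDB with rfl | rfl <;> assumption
  have hβD' : ∀ X, 0 < l X → β ≤ l (X + -D) := by
    rcases hnegD with h | h <;> rw [h] <;> assumption
  have hnear : ∀ D' X', (D' = B ∨ D' = -B) → IsAdmissible l H₀ D' X' →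
      l X' + β - l (X' + D') ≤ l X + β - l (X + D) + σ := by
    intro D' X' hD' hX'
    have h1 := hmax D' X' hD' hX'
    have h2 : 0 ≤ σ / 3 * (l H₀ - l X') ^ 2 := by positivity
    have h3 : (l H₀ - l X) ^ 2 ≤ 1 := by
      have := hl.nonneg X
      have := hl.mono hX.subset
      nlinarith
    have h4 : σ / 3 * σ ^ 2 * l H₀ / 3 ≤ σ / 9 := by
      have : σ ^ 2 * l H₀ ≤ 1 := by nlinarith
      nlinarith
    nlinarith
  have hδX := hnear B A (Or.inl rfl) hA
  have hlX := hβD X hX.pos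
  have hdX : d ≤ l X := by linarith
  have hXD : l (X + D) ≤ l H₀ - d := by
    have hC := hX.dual hl hD
    have h1 := hβD' _ hC.pos
    have h2 := density_dual_add_le hl hX.subset hD
    linarith
  obtain ⟨H, hHH₀, hH, hH'⟩ := exists_approximate_stabilizer hl hX.subset hσpos.le
    (by linarith) (fun g hg => inter_vadd_dichotomy hl hX hD hDne hσpos (by linarith)
      (fun X' hX' => hmax D X' hDB hX') (fun X' hX' => hmax (-D) X' hnegD hX') hg)
  obtain ⟨hfin, hh, hXH, q, hq⟩ :=
    exists_almost_full_coset hl hm hmix hσpos hdpos hdX hσ1 hH hH'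
  have hfinite : Finite (G ⧸ H) := AddSubgroup.finite_quotient_of_finiteIndex
  have hN := ncard_mul_le_add hl (D := D) hq
  have hDH : l (D + (H : Set G)) = ((QuotientAddGroup.mk : G → G ⧸ H) '' D).ncard * l H := by
    rw [IsInvariantDensity.add_subgroup_eq_preimage, hl.preimage_mk H (Set.toFinite _)]
  have hBH : l (B + (H : Set G)) = l (D + (H : Set G)) := by
    rcases hDB with rfl | rfl
    · rfl
    · rw [hl.neg_add_subgroup]
  have hDH1 := hl.le_one (D + (H : Set G))
  have hsd : σ / d ≤ ε / 6 := by
    rw [div_le_iff₀ hdpos]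
    linarith
  have hsd2 : σ / d ≤ d / 8 := by
    rw [div_le_iff₀ hdpos]
    linarith
  have hsd3 : σ ≤ σ / d := by
    rw [le_div_iff₀ hdpos]
    nlinarith
  have hNσ : ((QuotientAddGroup.mk : G → G ⧸ H) '' D).ncard * (2 * σ) ≤ 3 * (σ / d) := by
    rw [hDH] at hDH1
    have : ((QuotientAddGroup.mk : G → G ⧸ H) '' D).ncard * (7 / 8 * d) ≤ 1 :=
      (mul_le_mul_of_nonneg_left hh (Nat.cast_nonneg _)).trans hDH1
    rw [← mul_div_assoc, le_div_iff₀ hdpos]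
    nlinarith
  refine ⟨H, hHH₀, hfin, ?_, fun X' hX' => ?_⟩
  · rw [hBH]
    nlinarith
  · have := hnear B X' (Or.inl rfl) hX'
    rw [hBH]
    nlinarith

end Atom

section Saturation

variable {G : Type*} [AddCommGroup G]

/-- If a coset of `K` meets `A` in positive `l`-density and another one meets `B` in positive
`m`-density, then their sum is `l`-almost contained in `A + B`. -/
def IsSaturating (l m : Set G → ℝ) (A B : Set G) (K : AddSubgroup G) : Prop :=
  ∀ a b : G, 0 < l (A ∩ (a +ᵥ (K : Set G))) → 0 < m (B ∩ (b +ᵥ (K : Set G))) →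
    l (((a + b) +ᵥ (K : Set G)) \ (A + B)) = 0

variable {l m : Set G → ℝ} (hl : IsInvariantDensity l)
include hl

theorem IsInvariantDensity.nonempty_of_pos {A : Set G} (h : 0 < l A) : A.Nonempty := by
  rw [Set.nonempty_iff_ne_empty]
  rintro rfl
  rw [hl.empty] at h
  exact lt_irrefl _ h

theorem IsInvariantDensity.eq_zero_of_subset {A B : Set G} (h : A ⊆ B) (hB : l B = 0) :
    l A = 0 :=
  le_antisymm (hB ▸ hl.mono h) (hl.nonneg A)

theorem IsSaturating.mono (hm : IsInvariantDensity m) {A B : Set G} {K K' : AddSubgroup G}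
    (h : IsSaturating l m A B K) (hK : K' ≤ K) : IsSaturating l m A B K' := by
  have hc : ∀ g : G, g +ᵥ (K' : Set G) ⊆ g +ᵥ (K : Set G) := fun g => Set.vadd_set_mono hK
  intro a b ha hb
  exact hl.eq_zero_of_subset (Set.sdiff_subset_sdiff_left (hc _))
    (h a b (ha.trans_le (hl.mono (Set.inter_subset_inter_right _ (hc a))))
      (hb.trans_le (hm.mono (Set.inter_subset_inter_right _ (hc b)))))

omit hl in
theorem vadd_subgroup_eq {H : AddSubgroup G} {x z : G} (h : z ∈ x +ᵥ (H : Set G)) :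
    z +ᵥ (H : Set G) = x +ᵥ (H : Set G) := by
  rw [mem_leftAddCoset_iff] at h
  ext t
  rw [mem_leftAddCoset_iff, mem_leftAddCoset_iff]
  constructor
  · intro ht
    have := H.add_mem h ht
    change _ ∈ H
    convert this using 1
    abel
  · intro ht
    have := H.sub_mem ht h
    change _ ∈ H
    convert this using 1
    abel

omit hl in
theorem vadd_subgroup_subset {H H₀ : AddSubgroup G} (hH : H ≤ H₀) {x : G} (hx : x ∈ H₀) :
    x +ᵥ (H : Set G) ⊆ H₀ := by
  rintro _ ⟨t, ht, rfl⟩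
  exact H₀.add_mem hx (hH ht)

theorem add_le_of_add_lt (hmix : IsMixing l m) {H₀ : AddSubgroup G} {A B : Set G} (hA : A ⊆ H₀)
    (hB : B ⊆ H₀) (h : l (A + B) < l H₀) : l A + m B ≤ l H₀ := by
  have hC : 0 < l ((H₀ : Set G) \ (A + B)) := by
    rw [hl.sdiff_of_subset (add_subset_subgroup hA hB)]
    linarith
  linarith [hmix.le_add_neg hC B, density_dual_add_le hl hA hB]

theorem density_add_subgroup_add_le {H H₀ : AddSubgroup G} (hH : H ≤ H₀) {B : Set G}
    (hB : B ⊆ H₀) (hlt : l (B + (H : Set G)) < l H₀) :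
    l (B + (H : Set G)) + l H ≤ l H₀ := by
  have hsub : B + (H : Set G) ⊆ H₀ := add_subset_subgroup hB hH
  obtain ⟨z, hz, hz'⟩ : ((H₀ : Set G) \ (B + (H : Set G))).Nonempty :=
    hl.nonempty_of_pos (by rw [hl.sdiff_of_subset hsub]; linarith)
  rw [← hl.vadd z H]
  refine hl.add_le_of_disjoint hsub (vadd_subgroup_subset hH hz) ?_
  rw [Set.disjoint_left]
  rintro _ ⟨b, hb, t, ht, rfl⟩ ⟨s, hs, hst⟩
  refine hz' ⟨b, hb, t - s, H.sub_mem ht hs, ?_⟩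
  simp only [vadd_eq_add] at hst ⊢
  rw [← add_sub_assoc, ← hst, add_sub_cancel_right]

/-- The deficiency of the pair `A, B` is almost inherited by its pieces in any two cosets whose
sum is not filled. -/
theorem deficiency_coset_ge (hm : IsInvariantDensity m) (hmix : IsMixing l m)
    {H H₀ : AddSubgroup G} [H.FiniteIndex] (hH : H ≤ H₀) {A B : Set G} (hA : A ⊆ H₀)
    (hB : B ⊆ H₀) {ε : ℝ} (hε : 0 ≤ ε) (hlt : l (B + (H : Set G)) < l H₀)
    (hpos : 0 < l H + m B - l (B + (H : Set G)))
    (hmax : ∀ X, IsAdmissible l H₀ B X →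
      l X + m B - l (X + B) ≤ l H + m B - l (B + (H : Set G)) + ε)
    {x y : G} (hx : 0 < l (A ∩ (x +ᵥ (H : Set G)))) (hy : 0 < m (B ∩ (y +ᵥ (H : Set G))))
    (hxy : l ((A + B) ∩ ((x + y) +ᵥ (H : Set G))) < l H) :
    l A + m B - l (A + B) - ε ≤ l (A ∩ (x +ᵥ (H : Set G))) + m (B ∩ (y +ᵥ (H : Set G))) -
      l (A ∩ (x +ᵥ (H : Set G)) + B ∩ (y +ᵥ (H : Set G))) := by
  obtain ⟨b₀, hb₀, hb₀y⟩ := hm.nonempty_of_pos hy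
  obtain ⟨a₀, ha₀, ha₀x⟩ := hl.nonempty_of_pos hx
  have hmem : ∀ g z : G, z ∈ g +ᵥ (H : Set G) ↔ -g + z ∈ H := fun g z => mem_leftAddCoset_iff g
  have hxyH : (x + y) +ᵥ (H : Set G) ⊆ H₀ := by
    refine vadd_subgroup_subset hH (H₀.add_mem ?_ ?_)
    · have := H₀.sub_mem (hA ha₀) (hH ((hmem _ _).1 ha₀x))
      simpa using this
    · have := H₀.sub_mem (hB hb₀) (hH ((hmem _ _).1 hb₀y))
      simpa using this
  set E := x +ᵥ (H : Set G) with hE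
  set F := y +ᵥ (H : Set G) with hF
  set c := (x + y) +ᵥ (H : Set G) with hc
  have hEl : l E = l H := hl.vadd _ _
  have hcl : l c = l H := hl.vadd _ _
  have hEF : ∀ a ∈ E, ∀ b, a + b ∈ c ↔ b ∈ F := by
    intro a ha b
    rw [hmem] at ha ⊢
    rw [hmem, ← H.add_mem_cancel_left ha (y := -y + b)]
    abel_nf
  have hcF : ∀ z ∈ c, ∀ b, z + -b ∈ E ↔ b ∈ F := by
    intro z hz b
    rw [hmem] at hz ⊢
    rw [hmem, ← H.neg_mem_iff (x := -y + b), ← H.add_mem_cancel_left hz (y := -(-y + b))]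
    abel_nf
  have hγ : l (A ∩ E + B ∩ F) ≤ l ((A + B) ∩ c) := by
    apply hl.mono
    rintro _ ⟨a, ⟨ha, haE⟩, b, ⟨hb, hbF⟩, rfl⟩
    exact ⟨⟨a, ha, b, hb, rfl⟩, (hEF a haE b).2 hbF⟩
  have hC : 0 < l (c \ (A + B)) := by
    have := hl.inter_add_sdiff c (A + B)
    rw [Set.inter_comm] at this
    linarith
  have hBsplit : m (B \ F) = m B - m (B ∩ F) := by linarith [hm.inter_add_sdiff B F]
  have hβ : m (B ∩ F) ≤ l H := by
    rw [hl.eq_of_finiteIndex H hm, ← hm.vadd y H]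
    exact hm.mono Set.inter_subset_right
  set P : Set G := {z | x + y - z ∈ B + (H : Set G)} with hP
  have hPl : l P = l (B + (H : Set G)) := by
    rw [hP, IsInvariantDensity.add_subgroup_eq_preimage, ← hl.preimage_sub_mk H (x + y : G)]
    rfl
  have hEP : E ⊆ P := by
    intro z hz
    rw [hmem] at hz hb₀y
    refine ⟨b₀, hb₀, x + y - z - b₀, ?_, by simp⟩
    have := H.neg_mem (H.add_mem hz hb₀y)
    change _ ∈ H
    convert this using 1
    abel
  have hA'' : l ((A ∩ P) \ E) + (m B - m (B ∩ F)) ≤ l (B + (H : Set G)) - l H := by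
    rw [← hBsplit, ← hPl, ← hEl, ← hl.sdiff_of_subset hEP]
    refine (add_le_add_right (hmix.le_add_neg hC (B \ F)) _).trans ?_
    refine hl.add_le_of_disjoint (Set.sdiff_subset_sdiff_left Set.inter_subset_right) ?_ ?_
    · rintro _ ⟨z, ⟨hz, hz'⟩, b, ⟨hb, hb'⟩, rfl⟩
      have h1 := hcF z hz (-b)
      rw [neg_neg] at h1
      refine ⟨⟨-b, hb, x + y - z, ?_, ?_⟩, fun h => hb' (h1.1 h)⟩
      · rw [hmem] at hz
        have := H.neg_mem hz
        change _ ∈ H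
        convert this using 1
        abel
      · simp only
        abel
    · rw [Set.disjoint_left]
      rintro _ ⟨⟨hz, -⟩, -⟩ ⟨z, ⟨hzc, hz'⟩, b, ⟨hb, hb'⟩, rfl⟩
      exact hz' ⟨_, hz, -b, hb, by simp⟩
  have hAsplit : l A = l (A \ P) + l (A ∩ E) + l ((A ∩ P) \ E) := by
    have h1 := hl.inter_add_sdiff A P
    have h2 := hl.inter_add_sdiff (A ∩ P) E
    rw [Set.inter_assoc, Set.inter_eq_self_of_subset_right hEP] at h2
    linarith
  have hmiss : ∀ a ∉ P, ∀ b ∈ B, a + b ∉ c := by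
    intro a ha b hb hab
    rw [hmem] at hab
    refine ha ⟨b, hb, x + y - a - b, ?_, by simp⟩
    have := H.neg_mem hab
    change _ ∈ H
    convert this using 1
    abel
  rcases (hl.nonneg (A \ P)).lt_or_eq with hA' | hA'
  · have hdisj : Disjoint (A \ P + B) c := by
      rw [Set.disjoint_left]
      rintro _ ⟨a, ha, b, hb, rfl⟩
      exact hmiss a ha.2 b hb
    have hsub : A \ P + B ⊆ H₀ := add_subset_subgroup (Set.sdiff_subset.trans hA) hB
    have h1 := hl.add_le_of_disjoint hsub hxyH hdisj
    have h2 : l (A \ P + B) + l ((A + B) ∩ c) ≤ l (A + B) :=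
      hl.add_le_of_disjoint (Set.add_subset_add_right Set.sdiff_subset) Set.inter_subset_left
        (hdisj.mono_right Set.inter_subset_right)
    have h3 := hmax (A \ P) ⟨Set.sdiff_subset.trans hA, hA', by linarith [hl.pos H]⟩
    linarith
  · have hdisj : Disjoint (A ∩ E + B \ F) c := by
      rw [Set.disjoint_left]
      rintro _ ⟨a, ⟨-, ha⟩, b, ⟨-, hb⟩, rfl⟩ h
      exact hb ((hEF a ha b).1 h)
    have hmixB := hmix.le_add hx (B \ F)
    have hEB : l (E + B) = l (B + (H : Set G)) := by
      rw [hE, vadd_set_add, hl.vadd, add_comm]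
    by_cases hU : l (A ∪ E + B) < l H₀
    · have h1 := hl.submodular A E B
      have h2 := hl.union_add_inter A E
      have hEH₀ : E ⊆ H₀ := by
        refine vadd_subgroup_subset hH ?_
        have := H₀.sub_mem (hA ha₀) (hH ((hmem _ _).1 ha₀x))
        simpa using this
      have h3 := hmax (A ∪ E) ⟨Set.union_subset hA hEH₀,
        hx.trans_le (hl.mono (Set.inter_subset_left.trans Set.subset_union_left)), hU⟩
      have h4 : l (A ∩ E + B ∩ F) + l (A ∩ E + B \ F) ≤ l (A ∩ E + B) := by
        refine hl.add_le_of_disjoint (Set.add_subset_add_left Set.inter_subset_left)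
          (Set.add_subset_add_left Set.sdiff_subset) (hdisj.symm.mono_left ?_)
        rintro _ ⟨a, ⟨-, ha⟩, b, ⟨-, hb⟩, rfl⟩
        exact (hEF a ha b).2 hb
      linarith
    · have h1 := hl.union_add_inter (A + B) (E + B)
      rw [← Set.union_add] at h1
      have h2 : l (A ∩ E + B \ F) + l ((A + B) ∩ c) ≤ l ((A + B) ∩ (E + B)) := by
        refine hl.add_le_of_disjoint (Set.subset_inter
          (Set.add_subset_add Set.inter_subset_left Set.sdiff_subset)
          (Set.add_subset_add Set.inter_subset_right Set.sdiff_subset))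
          (Set.inter_subset_inter_right _ fun z hz => ?_)
          (hdisj.mono_right Set.inter_subset_right)
        exact ⟨z + -b₀, (hcF z hz b₀).2 hb₀y, b₀, hb₀, by simp⟩
      have h3 := density_add_subgroup_add_le hl hH hB hlt
      linarith

theorem isSaturating_of_le (hm : IsInvariantDensity m) {H₀ : AddSubgroup G} {A B : Set G}
    (hA : A ⊆ H₀) (hB : B ⊆ H₀) (h : l H₀ ≤ l (A + B)) : IsSaturating l m A B H₀ := by
  intro a b ha hb
  obtain ⟨a', ha', t, ht, hat⟩ := hl.nonempty_of_pos ha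
  obtain ⟨b', hb', s, hs, hbs⟩ := hm.nonempty_of_pos hb
  have hmem : ∀ (g t g' : G), g' ∈ H₀ → t ∈ H₀ → g +ᵥ t = g' → g ∈ H₀ := by
    rintro g t _ hg' ht rfl
    exact (H₀.add_mem_cancel_right ht).1 hg'
  have hab : (a + b) +ᵥ (H₀ : Set G) = H₀ := by
    have := vadd_subgroup_eq (H := H₀) (x := 0) (z := a + b) (by
      rw [zero_vadd]
      exact H₀.add_mem (hmem a t _ (hA ha') ht hat) (hmem b s _ (hB hb') hs hbs))
    rwa [zero_vadd] at this
  rw [hab]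
  have := hl.sdiff_of_subset (add_subset_subgroup hA hB)
  linarith [hl.nonneg ((H₀ : Set G) \ (A + B))]

theorem IsSaturating.of_translate {A B X Y : Set G} {x y : G} (hm : IsInvariantDensity m)
    (hXY : X + Y ⊆ A + B) {K : AddSubgroup G}
    (hK : IsSaturating l m (-x +ᵥ X) (-y +ᵥ Y) K) {a b : G}
    (ha : 0 < l (X ∩ (a +ᵥ (K : Set G)))) (hb : 0 < m (Y ∩ (b +ᵥ (K : Set G)))) :
    l (((a + b) +ᵥ (K : Set G)) \ (A + B)) = 0 := by
  have := hK (-x + a) (-y + b)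
    (by rwa [← vadd_eq_add, vadd_assoc, ← Set.vadd_set_inter, hl.vadd])
    (by rwa [← vadd_eq_add, vadd_assoc, ← Set.vadd_set_inter, hm.vadd])
  refine hl.eq_zero_of_subset (Set.sdiff_subset_sdiff_right hXY) ?_
  have hsum : (-x +ᵥ X) + (-y +ᵥ Y) = (-x + -y) +ᵥ (X + Y) := by
    rw [vadd_set_add, add_comm X, vadd_set_add, vadd_vadd, add_comm Y]
  rwa [hsum, add_add_add_comm, ← vadd_vadd, ← Set.vadd_set_sdiff, hl.vadd] at this

theorem exists_isSaturating (hm : IsInvariantDensity m) (hmix : IsMixing l m) (k : ℕ)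
    (H₀ : AddSubgroup G) (hH₀ : H₀.FiniteIndex) {A B : Set G} (hA : A ⊆ H₀) (hB : B ⊆ H₀)
    (hBne : B.Nonempty) (hApos : 0 < l A)
    (hk : (2 / 3 : ℝ) ^ k * l H₀ ≤ l A + m B - l (A + B)) :
    ∃ K : AddSubgroup G, K.FiniteIndex ∧ IsSaturating l m A B K := by
  induction k generalizing H₀ A B with
  | zero =>
    by_cases hfull : l (A + B) < l H₀
    · have h1 := add_le_of_add_lt hl hmix hA hB hfull
      obtain ⟨b, hb⟩ := hBne
      have h2 := hl.le_add_right (A := A) hb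
      rw [pow_zero, one_mul] at hk
      linarith
    · exact ⟨H₀, hH₀, isSaturating_of_le hl hm hA hB (not_lt.1 hfull)⟩
  | succ k ih =>
    by_cases hfull : l (A + B) < l H₀
    swap
    · exact ⟨H₀, hH₀, isSaturating_of_le hl hm hA hB (not_lt.1 hfull)⟩
    have hδ : 0 < l A + m B - l (A + B) :=
      lt_of_lt_of_le (mul_pos (by positivity) (hl.pos H₀)) hk
    obtain ⟨H, hH, hfin, hlt, hmax⟩ := exists_subgroup_near_max hl hm hmix hB hBne
      (fun X hX => hmix.le_add hX B) (fun X hX => hmix.le_add_neg hX B)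
      ⟨hA, hApos, hfull⟩ hδ (ε := (l A + m B - l (A + B)) / 4) (by linarith)
    have hδH := hmax A ⟨hA, hApos, hfull⟩
    have hhalf : 2 * l H ≤ l H₀ := by
      have := density_add_subgroup_add_le hl hH hB hlt
      obtain ⟨b, hb⟩ := hBne
      linarith [hl.le_add_left (B := (H : Set G)) hb]
    have hlocal : ∀ x y : G, ∃ K : AddSubgroup G, K.FiniteIndex ∧ ∀ a b : G,
        0 < l (A ∩ (x +ᵥ (H : Set G)) ∩ (a +ᵥ (K : Set G))) →
        0 < m (B ∩ (y +ᵥ (H : Set G)) ∩ (b +ᵥ (K : Set G))) →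
        l (((a + b) +ᵥ (K : Set G)) \ (A + B)) = 0 := by
      intro x y
      by_cases hx : 0 < l (A ∩ (x +ᵥ (H : Set G)))
      swap
      · exact ⟨H, hfin, fun a b ha _ => absurd (ha.trans_le (hl.mono Set.inter_subset_left)) hx⟩
      by_cases hy : 0 < m (B ∩ (y +ᵥ (H : Set G)))
      swap
      · exact ⟨H, hfin, fun a b _ hb => absurd (hb.trans_le (hm.mono Set.inter_subset_left)) hy⟩
      by_cases hxy : l ((A + B) ∩ ((x + y) +ᵥ (H : Set G))) < l H
      · have hdef := deficiency_coset_ge hl hm hmix hH hA hB (by linarith) hlt (by linarith)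
          hmax hx hy hxy
        have hsub : ∀ (S : Set G) (g : G), -g +ᵥ (S ∩ (g +ᵥ (H : Set G))) ⊆ H := by
          rintro S g _ ⟨_, ⟨-, t, ht, rfl⟩, rfl⟩
          simpa using ht
        have hsum : (-x +ᵥ A ∩ (x +ᵥ (H : Set G))) + (-y +ᵥ B ∩ (y +ᵥ (H : Set G))) =
            (-x + -y) +ᵥ (A ∩ (x +ᵥ (H : Set G)) + B ∩ (y +ᵥ (H : Set G))) := by
          rw [vadd_set_add, add_comm (A ∩ _), vadd_set_add, vadd_vadd, add_comm (B ∩ _)]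
        obtain ⟨K, hK, hsat⟩ := ih H hfin (hsub A x) (hsub B y)
          ((hm.nonempty_of_pos hy).image _) (by rwa [hl.vadd]) (by
            rw [hsum, hl.vadd, hl.vadd, hm.vadd]
            refine le_trans ?_ hdef
            have h1 := mul_le_mul_of_nonneg_left hhalf
              (show (0 : ℝ) ≤ (2 / 3) ^ k by positivity)
            rw [pow_succ] at hk
            linarith)
        exact ⟨K, hK, fun a b ha hb => hsat.of_translate hl hm
          (Set.add_subset_add Set.inter_subset_left Set.inter_subset_left) ha hb⟩
      · refine ⟨H, hfin, fun a b ha hb => ?_⟩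
        obtain ⟨s, ⟨-, hs⟩, hs'⟩ := hl.nonempty_of_pos ha
        obtain ⟨t, ⟨-, ht⟩, ht'⟩ := hm.nonempty_of_pos hb
        have hab : (a + b) +ᵥ (H : Set G) = (x + y) +ᵥ (H : Set G) := by
          rw [← vadd_vadd, ← vadd_subgroup_eq ht', vadd_subgroup_eq ht, vadd_comm,
            ← vadd_subgroup_eq hs', vadd_subgroup_eq hs, vadd_vadd, add_comm]
        rw [hab]
        have h1 := hl.inter_add_sdiff ((x + y) +ᵥ (H : Set G)) (A + B)
        rw [Set.inter_comm, hl.vadd] at h1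
        linarith [hl.nonneg (((x + y) +ᵥ (H : Set G)) \ (A + B))]
    choose K hK hKsat using hlocal
    have hfinite : Finite (G ⧸ H) := AddSubgroup.finite_quotient_of_finiteIndex
    have hiInf : (⨅ p : (G ⧸ H) × (G ⧸ H), K p.1.out p.2.out).FiniteIndex :=
      AddSubgroup.finiteIndex_iInf fun p => hK _ _
    refine ⟨H ⊓ ⨅ p : (G ⧸ H) × (G ⧸ H), K p.1.out p.2.out, inferInstance, fun a b ha hb => ?_⟩
    have hle : H ⊓ ⨅ p : (G ⧸ H) × (G ⧸ H), K p.1.out p.2.out ≤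
        K (a : G ⧸ H).out (b : G ⧸ H).out :=
      inf_le_right.trans (iInf_le (fun p : (G ⧸ H) × (G ⧸ H) => K p.1.out p.2.out) (↑a, ↑b))
    have hout : ∀ g : G, g +ᵥ ((H ⊓ ⨅ p : (G ⧸ H) × (G ⧸ H), K p.1.out p.2.out :
        AddSubgroup G) : Set G) ⊆ (g : G ⧸ H).out +ᵥ (H : Set G) := by
      intro g
      rw [← vadd_subgroup_eq (H := H) (x := (g : G ⧸ H).out) (z := g)]
      · exact Set.vadd_set_mono inf_le_left
      · rw [mem_leftAddCoset_iff]
        exact QuotientAddGroup.eq.1 (QuotientAddGroup.out_eq' _)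
    refine hl.eq_zero_of_subset (Set.sdiff_subset_sdiff_left (Set.vadd_set_mono hle))
      (hKsat _ _ a b (ha.trans_le (hl.mono ?_)) (hb.trans_le (hm.mono ?_)))
    · exact fun z hz => ⟨⟨hz.1, hout a hz.2⟩, Set.vadd_set_mono hle hz.2⟩
    · exact fun z hz => ⟨⟨hz.1, hout b hz.2⟩, Set.vadd_set_mono hle hz.2⟩

end Saturation

section Periodicity

variable {G : Type*} [AddCommGroup G]

/-- The cosets of `K` that meet `A` in positive density. -/
def posCosets (l : Set G → ℝ) (A : Set G) (K : AddSubgroup G) : Set (G ⧸ K) :=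
  {q | 0 < l (A ∩ (QuotientAddGroup.mk : G → G ⧸ K) ⁻¹' {q})}

variable {l m : Set G → ℝ} (hl : IsInvariantDensity l)
include hl

theorem IsInvariantDensity.eq_zero_of_cosets (K : AddSubgroup G) [K.FiniteIndex] {X : Set G}
    (h : ∀ q : G ⧸ K, l (X ∩ (QuotientAddGroup.mk : G → G ⧸ K) ⁻¹' {q}) ≤ 0) : l X = 0 := by
  have : Finite (G ⧸ K) := AddSubgroup.finite_quotient_of_finiteIndex
  have h1 := hl.le_ncard_mul K Set.finite_univ (S := X) (fun _ _ => Set.mem_univ _)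
    (fun q _ => h q)
  rw [mul_zero] at h1
  exact le_antisymm h1 (hl.nonneg X)

theorem density_sdiff_posCosets (A : Set G) (K : AddSubgroup G) [K.FiniteIndex] :
    l (A \ (QuotientAddGroup.mk : G → G ⧸ K) ⁻¹' posCosets l A K) = 0 := by
  refine hl.eq_zero_of_cosets K fun q => ?_
  by_cases hq : q ∈ posCosets l A K
  · refine (hl.eq_zero_of_subset ?_ hl.empty).le
    rintro x ⟨⟨-, hx⟩, rfl⟩
    exact hx hq
  · exact (hl.mono (Set.inter_subset_inter_left _ Set.sdiff_subset)).trans (not_lt.1 hq)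

theorem density_le_ncard_posCosets_mul (A : Set G) (K : AddSubgroup G) [K.FiniteIndex] :
    l A ≤ (posCosets l A K).ncard * l K := by
  have : Finite (G ⧸ K) := AddSubgroup.finite_quotient_of_finiteIndex
  rw [← hl.preimage_mk K (Set.toFinite _)]
  exact hl.le_of_sdiff_eq_zero (density_sdiff_posCosets hl A K)

theorem density_le_of_mem_posCosets {A : Set G} {K : AddSubgroup G} [K.FiniteIndex] {q : G ⧸ K}
    (hq : q ∈ posCosets l A K) :
    l A ≤ ((posCosets l A K).ncard - 1) * l K +
      l (A ∩ (QuotientAddGroup.mk : G → G ⧸ K) ⁻¹' {q}) := by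
  have : Finite (G ⧸ K) := AddSubgroup.finite_quotient_of_finiteIndex
  have h1 := hl.inter_add_sdiff A ((QuotientAddGroup.mk : G → G ⧸ K) ⁻¹' {q})
  have h2 : l (A \ (QuotientAddGroup.mk : G → G ⧸ K) ⁻¹' {q}) ≤
      l ((QuotientAddGroup.mk : G → G ⧸ K) ⁻¹' (posCosets l A K \ {q})) := by
    refine hl.le_of_sdiff_eq_zero (hl.eq_zero_of_subset ?_ (density_sdiff_posCosets hl A K))
    rintro x ⟨⟨hx, hxq⟩, hx'⟩
    exact ⟨hx, fun h => hx' ⟨h, hxq⟩⟩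
  rw [hl.preimage_mk K (Set.toFinite _)] at h2
  have h3 := Set.ncard_sdiff_singleton_add_one hq (Set.toFinite _)
  rw [← h3]
  push_cast
  linarith

theorem nonempty_posCosets {A : Set G} (hA : 0 < l A) (K : AddSubgroup G) [K.FiniteIndex] :
    (posCosets l A K).Nonempty := by
  by_contra h
  have := density_le_ncard_posCosets_mul hl A K
  rw [Set.not_nonempty_iff_eq_empty.1 h] at this
  simp only [Set.ncard_empty, Nat.cast_zero, zero_mul] at this
  linarith

theorem IsSaturating.sdiff_eq_zero {A B : Set G} {K : AddSubgroup G} [K.FiniteIndex]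
    (h : IsSaturating l m A B K) :
    l ((QuotientAddGroup.mk : G → G ⧸ K) ⁻¹' (posCosets l A K + posCosets m B K) \ (A + B)) =
      0 := by
  refine hl.eq_zero_of_cosets K fun q => ?_
  by_cases hq : q ∈ posCosets l A K + posCosets m B K
  · obtain ⟨s, hs, t, ht, rfl⟩ := hq
    obtain ⟨a, rfl⟩ := QuotientAddGroup.mk_surjective s
    obtain ⟨b, rfl⟩ := QuotientAddGroup.mk_surjective t
    have hs' : 0 < l (A ∩ (QuotientAddGroup.mk : G → G ⧸ K) ⁻¹' {(a : G ⧸ K)}) := hs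
    have ht' : 0 < m (B ∩ (QuotientAddGroup.mk : G → G ⧸ K) ⁻¹' {(b : G ⧸ K)}) := ht
    rw [IsInvariantDensity.preimage_mk_singleton] at hs' ht'
    refine (hl.eq_zero_of_subset ?_ (h a b hs' ht')).le
    rintro x ⟨⟨-, hx⟩, hxq⟩
    refine ⟨?_, hx⟩
    rw [← IsInvariantDensity.preimage_mk_singleton]
    exact hxq
  · refine (hl.eq_zero_of_subset ?_ hl.empty).le
    rintro x ⟨⟨hx, -⟩, rfl⟩
    exact hq hx

theorem exists_mem_posCosets {A : Set G} {K K' : AddSubgroup G} [K.FiniteIndex] {a : G}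
    (ha : 0 < l (A ∩ (a +ᵥ (K' : Set G)))) :
    ∃ g ∈ K', ((a + g : G) : G ⧸ K) ∈ posCosets l A K := by
  by_contra! hcon
  refine ha.ne' (hl.eq_zero_of_cosets K fun q => ?_)
  by_contra! hq
  obtain ⟨_, ⟨-, g, hg, rfl⟩, rfl⟩ := hl.nonempty_of_pos hq
  exact hcon g hg (hq.trans_le (hl.mono (Set.inter_subset_inter_left _ Set.inter_subset_left)))

theorem IsSaturating.comap_stabilizer (hm : IsInvariantDensity m) {A B : Set G}
    {K : AddSubgroup G} [K.FiniteIndex] (h : IsSaturating l m A B K) :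
    IsSaturating l m A B ((AddAction.stabilizer (G ⧸ K)
      (posCosets l A K + posCosets m B K)).comap (QuotientAddGroup.mk' K)) := by
  have : Finite (G ⧸ K) := AddSubgroup.finite_quotient_of_finiteIndex
  intro a b ha hb
  obtain ⟨s, hs, has⟩ := exists_mem_posCosets hl (K := K) ha
  obtain ⟨t, ht, hbt⟩ := exists_mem_posCosets hm (K := K) hb
  refine hl.eq_zero_of_subset (Set.sdiff_subset_sdiff_left ?_) (h.sdiff_eq_zero hl)
  rintro _ ⟨g, hg, rfl⟩
  have hst := AddSubgroup.sub_mem _ hg (AddSubgroup.add_mem _ hs ht)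
  have := (add_mem_iff_of_mem_stabilizer hst _).2 (Set.add_mem_add has hbt)
  rw [QuotientAddGroup.mk'_apply, ← QuotientAddGroup.mk_add, ← QuotientAddGroup.mk_add,
    show a + s + (b + t) + (g - (s + t)) = a + b + g by abel] at this
  exact this

/-- When `A + B` is small and the set of full cosets of `A + B` is aperiodic, `A` is contained in
the cosets which it meets in positive density. -/
theorem mk_mem_posCosets (hm : IsInvariantDensity m) {A B : Set G} {K : AddSubgroup G}
    [K.FiniteIndex] (hB : 0 < m B) (hlAB : l (A + B) < l A + m B) (hmAB : m (A + B) < l A + m B)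
    (hlK : l ((QuotientAddGroup.mk : G → G ⧸ K) ⁻¹' (posCosets l A K + posCosets m B K) \
      (A + B)) = 0)
    (hmK : m ((QuotientAddGroup.mk : G → G ⧸ K) ⁻¹' (posCosets l A K + posCosets m B K) \
      (A + B)) = 0)
    (hst : Nat.card (AddAction.stabilizer (G ⧸ K) (posCosets l A K + posCosets m B K)) = 1)
    {a : G} (ha : a ∈ A) : (a : G ⧸ K) ∈ posCosets l A K := by
  have : Finite (G ⧸ K) := AddSubgroup.finite_quotient_of_finiteIndex
  have hT := nonempty_posCosets hm hB K
  have hlA := density_le_ncard_posCosets_mul hl A K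
  have hmB := density_le_ncard_posCosets_mul hm B K
  have hlm := hl.eq_of_finiteIndex K hm
  have hlS := hl.le_of_sdiff_eq_zero hlK
  rw [hl.preimage_mk K (Set.toFinite _)] at hlS
  rw [← hlm] at hmB
  by_contra hcon
  by_cases hsub : ∀ t ∈ posCosets m B K, (a : G ⧸ K) + t ∈ posCosets l A K + posCosets m B K
  · have hins : insert (a : G ⧸ K) (posCosets l A K) + posCosets m B K =
        posCosets l A K + posCosets m B K := by
      refine subset_antisymm ?_ (Set.add_subset_add_right (Set.subset_insert _ _))
      rintro _ ⟨s, hs, t, ht, rfl⟩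
      rcases hs with rfl | hs
      · exact hsub t ht
      · exact Set.add_mem_add hs ht
    have hkn := ncard_add_ncard_le_ncard_add_card_stabilizer
      (insert (a : G ⧸ K) (posCosets l A K)) hT
    rw [hins, hst, Set.ncard_insert_of_notMem hcon (Set.toFinite _)] at hkn
    have hkn' : ((posCosets l A K).ncard + (posCosets m B K).ncard : ℝ) ≤
        (posCosets l A K + posCosets m B K).ncard := by
      exact_mod_cast (by omega : (posCosets l A K).ncard + (posCosets m B K).ncard ≤ _)
    have := mul_le_mul_of_nonneg_right hkn' (hl.nonneg K)
    linarith
  · push Not at hsub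
    obtain ⟨t, ht, hat⟩ := hsub
    have hkn := ncard_add_ncard_le_ncard_add_card_stabilizer (posCosets l A K) hT
    rw [hst] at hkn
    have hkn' : ((posCosets l A K).ncard + (posCosets m B K).ncard : ℝ) ≤
        (posCosets l A K + posCosets m B K).ncard + 1 := by exact_mod_cast hkn
    have h1 := mul_le_mul_of_nonneg_right hkn' (hl.nonneg K)
    have h2 := density_le_of_mem_posCosets hm ht
    rw [← hlm] at h2
    have h3 : m ((QuotientAddGroup.mk : G → G ⧸ K) ⁻¹' (posCosets l A K + posCosets m B K) ∩
        (A + B)) + m (a +ᵥ (B ∩ (QuotientAddGroup.mk : G → G ⧸ K) ⁻¹' {t})) ≤ m (A + B) := by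
      refine hm.add_le_of_disjoint Set.inter_subset_right ?_ ?_
      · rintro _ ⟨b, ⟨hb, -⟩, rfl⟩
        exact ⟨a, ha, b, hb, rfl⟩
      · rw [Set.disjoint_left]
        rintro _ ⟨hx, -⟩ ⟨b, ⟨-, rfl⟩, rfl⟩
        exact hat hx
    have h4 := hm.inter_add_sdiff ((QuotientAddGroup.mk : G → G ⧸ K) ⁻¹'
      (posCosets l A K + posCosets m B K)) (A + B)
    rw [hm.preimage_mk K (Set.toFinite _), hmK, ← hlm] at h4
    rw [hm.vadd] at h3
    linarith

theorem exists_finiteIndex_isSaturating (hm : IsInvariantDensity m) (hmix : IsMixing l m)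
    {A B : Set G} (hA : 0 < l A) (hB : 0 < m B) (hlAB : l (A + B) < l A + m B) :
    ∃ K : AddSubgroup G, K.FiniteIndex ∧ IsSaturating l m A B K := by
  obtain ⟨k, hk⟩ := exists_pow_lt_of_lt_one (show 0 < l A + m B - l (A + B) by linarith)
    (show (2 / 3 : ℝ) < 1 by norm_num)
  refine exists_isSaturating hl hm hmix k ⊤ inferInstance (Set.subset_univ _)
    (Set.subset_univ _) (hm.nonempty_of_pos hB) hA ?_
  rw [AddSubgroup.coe_top, hl.univ, mul_one]
  exact hk.le

theorem exists_finiteIndex_add_sdiff_eq_zero (hm : IsInvariantDensity m) (hlm : IsMixing l m)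
    (hml : IsMixing m l) {A B : Set G} (hA : 0 < l A) (hB : 0 < m B)
    (hlAB : l (A + B) < l A + m B) (hmAB : m (A + B) < l A + m B) :
    ∃ K : AddSubgroup G, K.FiniteIndex ∧ l ((A + B + (K : Set G)) \ (A + B)) = 0 := by
  let P : Set (AddSubgroup G) :=
    {K | K.FiniteIndex ∧ IsSaturating l m A B K ∧ IsSaturating m l B A K}
  have hP : P.Nonempty := by
    obtain ⟨K₁, hK₁, h₁⟩ := exists_finiteIndex_isSaturating hl hm hlm hA hB hlAB
    obtain ⟨K₂, hK₂, h₂⟩ := exists_finiteIndex_isSaturating hm hl hml hB hA (by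
      rw [add_comm B]
      linarith)
    exact ⟨K₁ ⊓ K₂, inferInstance, h₁.mono hl hm inf_le_left, h₂.mono hm hl inf_le_right⟩
  obtain ⟨K, ⟨hK, h₁, h₂⟩, hmin⟩ := (measure AddSubgroup.index).wf.has_min P hP
  have : Finite (G ⧸ K) := AddSubgroup.finite_quotient_of_finiteIndex
  have hst : Nat.card (AddAction.stabilizer (G ⧸ K) (posCosets l A K + posCosets m B K)) = 1 := by
    have h₂' := h₂.comap_stabilizer hm hl
    rw [add_comm (posCosets m B K)] at h₂'
    have hle : K ≤ (AddAction.stabilizer (G ⧸ K)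
        (posCosets l A K + posCosets m B K)).comap (QuotientAddGroup.mk' K) := by
      intro g hg
      rw [AddSubgroup.mem_comap, QuotientAddGroup.mk'_apply, (QuotientAddGroup.eq_zero_iff g).2 hg]
      exact AddSubgroup.zero_mem _
    have h3 := hmin _ ⟨AddSubgroup.finiteIndex_of_le hle, h₁.comap_stabilizer hl hm, h₂'⟩
    change ¬ _ < K.index at h3
    rw [AddSubgroup.index_comap_of_surjective _ (QuotientAddGroup.mk'_surjective K), not_lt,
      AddSubgroup.index, ← AddSubgroup.card_mul_index (AddAction.stabilizer (G ⧸ K)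
        (posCosets l A K + posCosets m B K))] at h3
    have h4 : 0 < (AddAction.stabilizer (G ⧸ K)
        (posCosets l A K + posCosets m B K)).index :=
      Nat.pos_of_ne_zero AddSubgroup.FiniteIndex.index_ne_zero
    have h5 := Nat.le_of_mul_le_mul_right (h3.trans_eq (one_mul _).symm) h4
    exact le_antisymm h5 Nat.card_pos
  have hlK := h₁.sdiff_eq_zero hl
  have hmK := h₂.sdiff_eq_zero hm
  have hAS := fun a => mk_mem_posCosets hl hm hB hlAB hmAB hlK
    (by rwa [add_comm A, add_comm (posCosets l A K)]) hst (a := a)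
  have hBT := fun b => mk_mem_posCosets hm hl hA (by rw [add_comm B]; linarith)
    (by rw [add_comm B]; linarith) hmK
    (by rwa [add_comm B, add_comm (posCosets m B K)])
    (by rwa [add_comm (posCosets m B K)]) (a := b)
  refine ⟨K, hK, hl.eq_zero_of_subset (Set.sdiff_subset_sdiff_left ?_) hlK⟩
  rw [IsInvariantDensity.add_subgroup_eq_preimage]
  apply Set.preimage_mono
  rintro _ ⟨_, ⟨a, ha, b, hb, rfl⟩, rfl⟩
  exact Set.add_mem_add (hAS a ha) (hBT b hb)

end Periodicity

section Means

variable {Γ}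

omit [AddCommGroup Γ] in
theorem ind_apply (A : Set Γ) (x : Γ) : ind Γ A x = A.indicator 1 x := rfl

omit [AddCommGroup Γ] in
theorem ind_of_mem {A : Set Γ} {x : Γ} (h : x ∈ A) : ind Γ A x = 1 :=
  Set.indicator_of_mem h _

omit [AddCommGroup Γ] in
theorem ind_of_notMem {A : Set Γ} {x : Γ} (h : x ∉ A) : ind Γ A x = 0 :=
  Set.indicator_of_notMem h _

theorem translate_apply (γ : Γ) (f : BoundedContinuousFunction Γ ℝ) (x : Γ) :
    translate Γ γ f x = f (x - γ) := rfl

omit [AddCommGroup Γ] in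
theorem ind_univ : ind Γ Set.univ = 1 := by
  ext x
  simp [ind_apply]

omit [AddCommGroup Γ] in
theorem ind_union {A B : Set Γ} (h : Disjoint A B) : ind Γ (A ∪ B) = ind Γ A + ind Γ B := by
  ext x
  simp [ind_apply, Set.indicator_union_of_disjoint h]

omit [AddCommGroup Γ] in
theorem ind_nonneg (A : Set Γ) (x : Γ) : 0 ≤ ind Γ A x :=
  Set.indicator_nonneg (fun _ _ => zero_le_one) x

omit [AddCommGroup Γ] in
theorem ind_le_one (A : Set Γ) (x : Γ) : ind Γ A x ≤ 1 :=
  Set.indicator_le_self' (fun _ _ => zero_le_one) x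

theorem ind_vadd (g : Γ) (A : Set Γ) : ind Γ (g +ᵥ A) = translate Γ g (ind Γ A) := by
  ext x
  have : x ∈ g +ᵥ A ↔ x - g ∈ A := by
    rw [Set.mem_vadd_set_iff_neg_vadd_mem, vadd_eq_add, neg_add_eq_sub]
  rw [translate_apply]
  by_cases h : x - g ∈ A
  · rw [ind_of_mem h, ind_of_mem (this.2 h)]
  · rw [ind_of_notMem h, ind_of_notMem fun h' => h (this.1 h')]

theorem ind_mul_translate_ind (X Y : Set Γ) (t : Γ) :
    ind Γ X * translate Γ t (ind Γ Y) = ind Γ (X ∩ (t +ᵥ Y)) := by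
  rw [← ind_vadd]
  ext x
  rw [BoundedContinuousFunction.mul_apply, ind_apply, ind_apply, ind_apply,
    Set.inter_indicator_one, Pi.mul_apply]

namespace IsInvariantMean

variable {m : BoundedContinuousFunction Γ ℝ →ₗ[ℝ] ℝ} (hm : IsInvariantMean Γ m)
include hm

theorem monotone {f g : BoundedContinuousFunction Γ ℝ} (h : ∀ x, f x ≤ g x) : m f ≤ m g := by
  have := hm.nonneg (g - f) fun x => by simpa using h x
  rw [map_sub] at this
  linarith

theorem abs_le (f : BoundedContinuousFunction Γ ℝ) : |m f| ≤ ‖f‖ := by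
  have h1 : m (‖f‖ • 1) = ‖f‖ := by rw [map_smul, hm.map_one, smul_eq_mul, mul_one]
  have hf : ∀ x, |f x| ≤ ‖f‖ := fun x => f.norm_coe_le_norm x
  rw [_root_.abs_le]
  constructor
  · have := hm.monotone (f := -(‖f‖ • 1)) (g := f) fun x => by
      simpa using (_root_.abs_le.1 (hf x)).1
    rwa [map_neg, h1] at this
  · have := hm.monotone (f := f) (g := ‖f‖ • 1) fun x => by
      simpa using (_root_.abs_le.1 (hf x)).2
    rwa [h1] at this

theorem isInvariantDensity : IsInvariantDensity (mVal Γ m) where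
  nonneg A := hm.nonneg _ (ind_nonneg A)
  univ := by rw [mVal, ind_univ, hm.map_one]
  union A B h := by rw [mVal, ind_union h, map_add, mVal, mVal]
  vadd g A := by rw [mVal, ind_vadd, hm.invariant, mVal]

theorem mVal_le_ubd (A : Set Γ) : mVal Γ m A ≤ ubd Γ A := by
  refine le_csSup ⟨1, ?_⟩ ⟨m, hm, rfl⟩
  rintro _ ⟨n, hn, rfl⟩
  exact hn.isInvariantDensity.le_one A

end IsInvariantMean

theorem norm_translate_le (γ : Γ) (f : BoundedContinuousFunction Γ ℝ) :
    ‖translate Γ γ f‖ ≤ ‖f‖ :=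
  (BoundedContinuousFunction.norm_le (norm_nonneg f)).2 fun x => f.norm_coe_le_norm (x - γ)

/-- The function `t ↦ l (g * τ_t f)`. -/
noncomputable def correlation {l : BoundedContinuousFunction Γ ℝ →ₗ[ℝ] ℝ}
    (hl : IsInvariantMean Γ l) (g f : BoundedContinuousFunction Γ ℝ) :
    BoundedContinuousFunction Γ ℝ :=
  BoundedContinuousFunction.ofNormedAddCommGroup (fun t => l (g * translate Γ t f))
    continuous_of_discreteTopology (‖g‖ * ‖f‖) fun t =>
      (hl.abs_le _).trans ((norm_mul_le _ _).trans
        (mul_le_mul_of_nonneg_left (norm_translate_le t f) (norm_nonneg g)))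

theorem correlation_apply {l : BoundedContinuousFunction Γ ℝ →ₗ[ℝ] ℝ}
    (hl : IsInvariantMean Γ l) (g f : BoundedContinuousFunction Γ ℝ) (t : Γ) :
    correlation hl g f t = l (g * translate Γ t f) := rfl

/-- The functional averaging the correlations `l (g * τ_t f)` over `t` with respect to `m`. -/
noncomputable def meanCorrelation {l : BoundedContinuousFunction Γ ℝ →ₗ[ℝ] ℝ}
    (hl : IsInvariantMean Γ l) (m : BoundedContinuousFunction Γ ℝ →ₗ[ℝ] ℝ)
    (g : BoundedContinuousFunction Γ ℝ) : BoundedContinuousFunction Γ ℝ →ₗ[ℝ] ℝ where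
  toFun f := m (correlation hl g f)
  map_add' f f' := by
    rw [← map_add]
    congr 1
    ext t
    have : translate Γ t (f + f') = translate Γ t f + translate Γ t f' := rfl
    simp only [correlation_apply, BoundedContinuousFunction.coe_add, Pi.add_apply]
    rw [this, mul_add, map_add]
  map_smul' r f := by
    rw [RingHom.id_apply, ← map_smul]
    congr 1
    ext t
    have : translate Γ t (r • f) = r • translate Γ t f := rfl
    simp only [correlation_apply, BoundedContinuousFunction.coe_smul]
    rw [this, mul_smul_comm, map_smul]

section MeanCorrelation

variable {l m : BoundedContinuousFunction Γ ℝ →ₗ[ℝ] ℝ} (hl : IsInvariantMean Γ l)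
  (hm : IsInvariantMean Γ m)

theorem meanCorrelation_apply (g f : BoundedContinuousFunction Γ ℝ) :
    meanCorrelation hl m g f = m (correlation hl g f) := rfl

include hm

theorem meanCorrelation_nonneg {g f : BoundedContinuousFunction Γ ℝ} (hg : ∀ x, 0 ≤ g x)
    (hf : ∀ x, 0 ≤ f x) : 0 ≤ meanCorrelation hl m g f :=
  hm.nonneg _ fun t => hl.nonneg _ fun x => mul_nonneg (hg x) (hf (x - t))

theorem meanCorrelation_one (g : BoundedContinuousFunction Γ ℝ) :
    meanCorrelation hl m g 1 = l g := by
  have : correlation hl g 1 = l g • 1 := by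
    ext t
    have : translate Γ t 1 = 1 := rfl
    simp [correlation_apply, this]
  rw [meanCorrelation_apply, this, map_smul, hm.map_one, smul_eq_mul, mul_one]

theorem one_meanCorrelation (f : BoundedContinuousFunction Γ ℝ) :
    meanCorrelation hl m 1 f = l f := by
  have : correlation hl 1 f = l f • 1 := by
    ext t
    simp [correlation_apply, hl.invariant]
  rw [meanCorrelation_apply, this, map_smul, hm.map_one, smul_eq_mul, mul_one]

omit hm in
theorem add_meanCorrelation (g g' f : BoundedContinuousFunction Γ ℝ) :
    meanCorrelation hl m (g + g') f = meanCorrelation hl m g f + meanCorrelation hl m g' f := by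
  rw [meanCorrelation_apply, meanCorrelation_apply, meanCorrelation_apply, ← map_add]
  congr 1
  ext t
  simp [correlation_apply, add_mul]

theorem meanCorrelation_translate (g f : BoundedContinuousFunction Γ ℝ) (γ : Γ) :
    meanCorrelation hl m g (translate Γ γ f) = meanCorrelation hl m g f := by
  have : correlation hl g (translate Γ γ f) = translate Γ (-γ) (correlation hl g f) := by
    ext t
    have : translate Γ t (translate Γ γ f) = translate Γ (t - -γ) f := by
      ext x
      simp only [translate_apply]
      congr 1
      abel
    rw [translate_apply, correlation_apply, correlation_apply, this]
  rw [meanCorrelation_apply, this, hm.invariant, meanCorrelation_apply]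

theorem isInvariantMean_inv_smul_meanCorrelation {g : BoundedContinuousFunction Γ ℝ}
    (hg : ∀ x, 0 ≤ g x) (hpos : 0 < l g) :
    IsInvariantMean Γ ((l g)⁻¹ • meanCorrelation hl m g) where
  map_one := by
    rw [LinearMap.smul_apply, meanCorrelation_one hl hm, smul_eq_mul, inv_mul_cancel₀ hpos.ne']
  nonneg f hf := mul_nonneg (inv_nonneg.2 hpos.le) (meanCorrelation_nonneg hl hm hg hf)
  invariant γ f := by
    rw [LinearMap.smul_apply, LinearMap.smul_apply, meanCorrelation_translate hl hm]

end MeanCorrelation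

theorem meanCorrelation_ind {l m : BoundedContinuousFunction Γ ℝ →ₗ[ℝ] ℝ}
    (hl : IsExtremeInvariantMean Γ l) (hm : IsInvariantMean Γ m) (X Y : Set Γ) :
    meanCorrelation hl.1 m (ind Γ X) (ind Γ Y) = mVal Γ l X * mVal Γ l Y := by
  have hle : ∀ Z : Set Γ, meanCorrelation hl.1 m (ind Γ Z) (ind Γ Y) ≤ mVal Γ l Z := by
    intro Z
    have := meanCorrelation_nonneg hl.1 hm (g := ind Γ Z) (f := 1 - ind Γ Y) (ind_nonneg Z)
      fun x => by simpa using ind_le_one Y x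
    rw [map_sub, meanCorrelation_one hl.1 hm] at this
    exact sub_nonneg.1 this
  have hsum : ∀ f, meanCorrelation hl.1 m (ind Γ X) f + meanCorrelation hl.1 m (ind Γ Xᶜ) f =
      l f := by
    intro f
    rw [← add_meanCorrelation, ← ind_union disjoint_compl_right, Set.union_compl_self, ind_univ,
      one_meanCorrelation hl.1 hm]
  have h0 := fun Z : Set Γ => meanCorrelation_nonneg hl.1 hm (ind_nonneg Z) (ind_nonneg Y)
  have hcompl := hl.1.isInvariantDensity.compl X
  rcases (hl.1.isInvariantDensity.nonneg X).eq_or_lt with hX | hX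
  · rw [← hX, zero_mul]
    exact le_antisymm ((hle X).trans_eq hX.symm) (h0 X)
  rcases (hl.1.isInvariantDensity.nonneg Xᶜ).eq_or_lt with hX' | hX'
  · have h1 : mVal Γ l X = 1 := by linarith
    have h2 := le_antisymm ((hle Xᶜ).trans_eq hX'.symm) (h0 Xᶜ)
    have h3 := hsum (ind Γ Y)
    rw [h2, add_zero] at h3
    rw [h3, h1, one_mul, mVal]
  · have h1 := (mem_extremePoints.1 hl).2
      _ (isInvariantMean_inv_smul_meanCorrelation hl.1 hm (ind_nonneg X) hX)
      _ (isInvariantMean_inv_smul_meanCorrelation hl.1 hm (ind_nonneg Xᶜ) hX')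
      ⟨mVal Γ l X, mVal Γ l Xᶜ, hX, hX', by linarith, by
        ext f
        rw [mVal, mVal] at *
        rw [smul_smul, smul_smul, mul_inv_cancel₀ hX.ne', mul_inv_cancel₀ hX'.ne', one_smul,
          one_smul]
        exact hsum f⟩
    have h2 := LinearMap.congr_fun h1.1 (ind Γ Y)
    rw [LinearMap.smul_apply, smul_eq_mul] at h2
    exact (inv_mul_eq_iff_eq_mul₀ hX.ne').1 h2

/-- The reflection of an invariant mean under `x ↦ -x`. -/
noncomputable def reflect (m : BoundedContinuousFunction Γ ℝ →ₗ[ℝ] ℝ) :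
    BoundedContinuousFunction Γ ℝ →ₗ[ℝ] ℝ where
  toFun f := m (f.compContinuous ⟨fun x => -x, continuous_of_discreteTopology⟩)
  map_add' f g := by rw [← map_add]; rfl
  map_smul' r f := by rw [← map_smul]; rfl

theorem IsInvariantMean.reflect {m : BoundedContinuousFunction Γ ℝ →ₗ[ℝ] ℝ}
    (hm : IsInvariantMean Γ m) : IsInvariantMean Γ (reflect m) where
  map_one := hm.map_one
  nonneg f hf := hm.nonneg _ fun x => hf (-x)
  invariant γ f := by
    rw [SumsetMeans.reflect, LinearMap.coe_mk, AddHom.coe_mk, ← hm.invariant γ]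
    congr 1
    ext x
    simp [translate_apply]

theorem mVal_reflect (m : BoundedContinuousFunction Γ ℝ →ₗ[ℝ] ℝ) (T : Set Γ) :
    mVal Γ (reflect m) (-T) = mVal Γ m T := by
  rw [mVal, reflect, LinearMap.coe_mk, AddHom.coe_mk, mVal]
  congr 1
  ext x
  change ind Γ (-T) (-x) = ind Γ T x
  by_cases h : x ∈ T
  · rw [ind_of_mem h, ind_of_mem (Set.neg_mem_neg.2 h)]
  · rw [ind_of_notMem h, ind_of_notMem fun h' => h (Set.neg_mem_neg.1 h')]

theorem IsExtremeInvariantMean.mul_mVal_le {l m : BoundedContinuousFunction Γ ℝ →ₗ[ℝ] ℝ}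
    (hl : IsExtremeInvariantMean Γ l) (hm : IsInvariantMean Γ m) {X Y T : Set Γ} {p : ℝ}
    (h : ∀ t ∈ T, p ≤ mVal Γ l (X ∩ (t +ᵥ Y))) :
    p * mVal Γ m T ≤ mVal Γ l X * mVal Γ l Y := by
  rw [← meanCorrelation_ind hl hm, meanCorrelation_apply, mVal, ← smul_eq_mul, ← map_smul]
  refine hm.monotone fun t => ?_
  rw [correlation_apply, ind_mul_translate_ind]
  by_cases ht : t ∈ T
  · simpa [ind_of_mem ht, mVal] using h t ht
  · simpa [ind_of_notMem ht, mVal] using hl.1.isInvariantDensity.nonneg (X ∩ (t +ᵥ Y))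

theorem IsExtremeInvariantMean.isMixing {l m : BoundedContinuousFunction Γ ℝ →ₗ[ℝ] ℝ}
    (hl : IsExtremeInvariantMean Γ l) (hm : IsInvariantMean Γ m) :
    IsMixing (mVal Γ l) (mVal Γ m) where
  vadd _ _ _ _ h := hl.mul_mVal_le hm h
  neg_vadd X Y T p h := by
    rw [← mVal_reflect]
    exact hl.mul_mVal_le hm.reflect fun t ht => by simpa using h (-t) ht

theorem isCompact_image_isInvariantMean :
    IsCompact ((fun m : BoundedContinuousFunction Γ ℝ →ₗ[ℝ] ℝ => (⇑m : _ → ℝ)) ''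
      {m | IsInvariantMean Γ m}) := by
  refine (isCompact_univ_pi fun f : BoundedContinuousFunction Γ ℝ =>
    isCompact_Icc (a := -‖f‖) (b := ‖f‖)).of_isClosed_subset ?_ ?_
  · have : ((fun m : BoundedContinuousFunction Γ ℝ →ₗ[ℝ] ℝ => (⇑m : _ → ℝ)) ''
        {m | IsInvariantMean Γ m}) =
        {φ | (∀ f g, φ (f + g) = φ f + φ g) ∧ (∀ (r : ℝ) f, φ (r • f) = r • φ f) ∧ φ 1 = 1 ∧
          (∀ f, (∀ x, 0 ≤ f x) → 0 ≤ φ f) ∧ ∀ γ f, φ (translate Γ γ f) = φ f} := by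
      ext φ
      constructor
      · rintro ⟨m, hm, rfl⟩
        exact ⟨map_add m, map_smul m, hm.map_one, hm.nonneg, hm.invariant⟩
      · rintro ⟨h1, h2, h3, h4, h5⟩
        exact ⟨⟨⟨φ, h1⟩, h2⟩, ⟨h3, h4, h5⟩, rfl⟩
    rw [this]
    simp only [Set.ofPred_and, Set.ofPred_forall]
    refine IsClosed.inter ?_ (IsClosed.inter ?_ (IsClosed.inter ?_ (IsClosed.inter ?_ ?_)))
    · exact isClosed_iInter fun f => isClosed_iInter fun g => isClosed_eq (by fun_prop) (by fun_prop)
    · exact isClosed_iInter fun r => isClosed_iInter fun f => isClosed_eq (by fun_prop) (by fun_prop)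
    · exact isClosed_eq (by fun_prop) (by fun_prop)
    · exact isClosed_iInter fun f => isClosed_iInter fun _ => isClosed_le (by fun_prop) (by fun_prop)
    · exact isClosed_iInter fun γ => isClosed_iInter fun f => isClosed_eq (by fun_prop) (by fun_prop)
  · rintro _ ⟨m, hm, rfl⟩ f -
    exact _root_.abs_le.1 (hm.abs_le f)

theorem exists_isExtremeInvariantMean_mVal_eq_ubd {m₀ : BoundedContinuousFunction Γ ℝ →ₗ[ℝ] ℝ}
    (hm₀ : IsInvariantMean Γ m₀) (A : Set Γ) :
    ∃ l, IsExtremeInvariantMean Γ l ∧ mVal Γ l A = ubd Γ A := by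
  set M := (fun m : BoundedContinuousFunction Γ ℝ →ₗ[ℝ] ℝ => (⇑m : _ → ℝ)) ''
    {m | IsInvariantMean Γ m} with hM
  have hcomp : IsCompact M := isCompact_image_isInvariantMean
  let e : StrongDual ℝ (BoundedContinuousFunction Γ ℝ → ℝ) :=
    ContinuousLinearMap.proj (R := ℝ) (φ := fun _ : BoundedContinuousFunction Γ ℝ => ℝ) (ind Γ A)
  have hexp : IsExposed ℝ M {φ ∈ M | ∀ ψ ∈ M, e ψ ≤ e φ} := fun _ => ⟨e, rfl⟩
  obtain ⟨φ, hφ, hmax⟩ := hcomp.exists_isMaxOn ⟨_, m₀, hm₀, rfl⟩ e.continuous.continuousOn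
  obtain ⟨ψ, hψ⟩ := (hexp.isCompact hcomp).extremePoints_nonempty ⟨φ, hφ, hmax⟩
  have hψM := hexp.isExtreme.extremePoints_subset_extremePoints hψ
  obtain ⟨⟨l, hl, rfl⟩, hlmax⟩ := hψ.1
  refine ⟨l, mem_extremePoints.2 ⟨hl, fun m₁ h₁ m₂ h₂ hseg => ?_⟩, ?_⟩
  · obtain ⟨a, b, ha, hb, hab, rfl⟩ := hseg
    have := (mem_extremePoints.1 hψM).2 _ ⟨m₁, h₁, rfl⟩ _ ⟨m₂, h₂, rfl⟩
      ⟨a, b, ha, hb, hab, rfl⟩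
    exact ⟨DFunLike.coe_injective this.1, DFunLike.coe_injective this.2⟩
  · refine le_antisymm (hl.mVal_le_ubd A) (csSup_le ⟨_, m₀, hm₀, rfl⟩ ?_)
    rintro _ ⟨n, hn, rfl⟩
    exact hlmax _ ⟨n, hn, rfl⟩

end Means

theorem ubd_kneser (A B : Set Γ) (hA : A.Nonempty) (hB : B.Nonempty)
    (h : ubd Γ (A + B) < ubd Γ A + ubd Γ B) :
    ∃ K : AddSubgroup Γ, K.FiniteIndex ∧
      ubd Γ (A + B) = ubd Γ (A + B + (K : Set Γ)) := by
  obtain ⟨m₀, hm₀⟩ : ∃ m, IsInvariantMean Γ m := by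
    by_contra! hcon
    have h0 : ∀ S, ubd Γ S = 0 := by
      intro S
      have : {x : ℝ | ∃ m, IsInvariantMean Γ m ∧ mVal Γ m S = x} = ∅ := by
        rw [Set.eq_empty_iff_forall_notMem]
        rintro x ⟨m, hm, -⟩
        exact hcon m hm
      rw [ubd, this, Real.sSup_empty]
    rw [h0, h0, h0] at h
    linarith
  obtain ⟨l, hlext, hlA⟩ := exists_isExtremeInvariantMean_mVal_eq_ubd hm₀ A
  obtain ⟨m, hmext, hmB⟩ := exists_isExtremeInvariantMean_mVal_eq_ubd hm₀ B
  have hl : IsInvariantDensity (mVal Γ l) := hlext.1.isInvariantDensity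
  have hm : IsInvariantDensity (mVal Γ m) := hmext.1.isInvariantDensity
  have hlAB := hlext.1.mVal_le_ubd (A + B)
  have hmAB := hmext.1.mVal_le_ubd (A + B)
  have hApos : 0 < mVal Γ l A := by
    obtain ⟨a, ha⟩ := hA
    linarith [hm.le_add_left (B := B) ha]
  have hBpos : 0 < mVal Γ m B := by
    obtain ⟨b, hb⟩ := hB
    linarith [hl.le_add_right (A := A) hb]
  obtain ⟨K, hK, hnull⟩ := exists_finiteIndex_add_sdiff_eq_zero hl hm (hlext.isMixing hmext.1)
    (hmext.isMixing hlext.1) hApos hBpos (by linarith) (by linarith)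
  have hfinite : Finite (Γ ⧸ K) := AddSubgroup.finite_quotient_of_finiteIndex
  refine ⟨K, hK, le_antisymm ?_ ?_⟩
  · refine csSup_le ⟨_, m₀, hm₀, rfl⟩ ?_
    rintro _ ⟨n, hn, rfl⟩
    exact (hn.isInvariantDensity.le_add_right K.zero_mem).trans (hn.mVal_le_ubd _)
  · refine csSup_le ⟨_, m₀, hm₀, rfl⟩ ?_
    rintro _ ⟨n, hn, rfl⟩
    have hn' := hn.isInvariantDensity
    refine le_trans (le_of_eq ?_) ((hl.le_of_sdiff_eq_zero hnull).trans hlAB)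
    rw [IsInvariantDensity.add_subgroup_eq_preimage, hn'.preimage_mk K (Set.toFinite _),
      hl.preimage_mk K (Set.toFinite _), hn'.eq_of_finiteIndex K hl]

end SumsetMeans
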